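/- Assume n > 2γ + 8. Then ∫_0^∞ ∫_{ℝⁿ} x_N^{1-2γ} |x̄|⁴ W₁(x̄, x_N)² dx̄ dx_N = |S^{n-1}| · [ n(n+2)(15(n-3)²(n-5)² + R) / (15(n-4)(n-6)(n-2γ-4)(n+2γ-4)(n-2γ-6)(n+2γ-6)) ] · A₁ B₂, where R = (1-4γ²)(10n² - 80n + 177 - 12γ²). -/

import Mathlib

open MeasureTheory Real Filter Topology

noncomputable section

/-- The constant `c_{n,γ}` in the definition of the standard bubble. -/
def cng (n : ℕ) (γ : ℝ) : ℝ :=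
  2 ^ (((n : ℝ) - 2 * γ) / 2) *
    (Real.Gamma (((n : ℝ) + 2 * γ) / 2) / Real.Gamma (((n : ℝ) - 2 * γ) / 2)) ^
      (((n : ℝ) - 2 * γ) / (4 * γ))

/-- The constant `p_{n,γ}` in the Poisson kernel. -/
def png (n : ℕ) (γ : ℝ) : ℝ :=
  Real.Gamma (((n : ℝ) + 2 * γ) / 2) / (Real.pi ^ ((n : ℝ) / 2) * Real.Gamma γ)

/-- The bubble `w_{λ,σ}` on `ℝⁿ`. -/
def bubble (n : ℕ) (γ lam : ℝ) (σ : EuclideanSpace ℝ (Fin n))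
    (x : EuclideanSpace ℝ (Fin n)) : ℝ :=
  cng n γ * (lam / (lam ^ 2 + ‖x - σ‖ ^ 2)) ^ (((n : ℝ) - 2 * γ) / 2)

/-- The extension `W_{λ,σ}` of the bubble to the upper half space, given by
convolution with the Poisson kernel. -/
def bubbleExt (n : ℕ) (γ lam : ℝ) (σ : EuclideanSpace ℝ (Fin n))
    (x : EuclideanSpace ℝ (Fin n)) (xN : ℝ) : ℝ :=
  png n γ * ∫ ξ : EuclideanSpace ℝ (Fin n),
    xN ^ (2 * γ) / (‖x - ξ‖ ^ 2 + xN ^ 2) ^ (((n : ℝ) + 2 * γ) / 2) * bubble n γ lam σ ξ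

/-- The modified Bessel function of the second kind `K_γ`. -/
def besselK (γ t : ℝ) : ℝ :=
  ∫ s in Set.Ioi (0 : ℝ), Real.exp (-t * Real.cosh s) * Real.cosh (γ * s)

/-- The function `φ(t) = (2^{1-γ}/Γ(γ)) t^γ K_γ(t)`. -/
def phiK (γ t : ℝ) : ℝ := (2 ^ (1 - γ) / Real.Gamma γ) * t ^ γ * besselK γ t

/-- The constant `d₂`. -/
def dTwo (n : ℕ) (γ : ℝ) : ℝ :=
  2 * Real.Gamma (((n : ℝ) + 2 * γ) / 2) ^ (((n : ℝ) - 2 * γ) / (4 * γ)) /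
    Real.Gamma (((n : ℝ) - 2 * γ) / 2) ^ (((n : ℝ) + 2 * γ) / (4 * γ))

/-- The radial profile `ŵ₁(ρ) = d₂ ρ^{-γ} K_γ(ρ)` of the Fourier transform of the
standard bubble. -/
def whatOne (n : ℕ) (γ ρ : ℝ) : ℝ := dTwo n γ * ρ ^ (-γ) * besselK γ ρ

/-- The constant `A₁ = ∫_0^∞ t^{1-2γ} φ(t)² dt`. -/
def Aone (γ : ℝ) : ℝ := ∫ t in Set.Ioi (0 : ℝ), t ^ (1 - 2 * γ) * (phiK γ t) ^ 2

/-- The constant `B₂ = ∫_0^∞ ρ^{n-3+2γ} ŵ₁(ρ)² dρ`. -/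
def Btwo (n : ℕ) (γ : ℝ) : ℝ :=
  ∫ ρ in Set.Ioi (0 : ℝ), ρ ^ ((n : ℝ) - 3 + 2 * γ) * (whatOne n γ ρ) ^ 2

/-- The total surface measure `|S^{n-1}|` of the unit sphere in `ℝⁿ`. -/
def sphereConst (n : ℕ) : ℝ := 2 * Real.pi ^ ((n : ℝ) / 2) / Real.Gamma ((n : ℝ) / 2)

open Set
open scoped ENNReal

/-! ### Substitutions and Gamma integrals for lower integrals -/

lemma lintegral_ofReal_eq_of_integral_eq {α : Type*} [MeasurableSpace α] {μ : Measure α}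
    {f : α → ℝ} {c : ℝ} (h0 : 0 ≤ᵐ[μ] f) (h : ∫ x, f x ∂μ = c) (hc : 0 < c) :
    ∫⁻ x, ENNReal.ofReal (f x) ∂μ = ENNReal.ofReal c := by
  have hi : Integrable f μ := Integrable.of_integral_ne_zero (by rw [h]; exact hc.ne')
  rw [← h, ofReal_integral_eq_lintegral_ofReal hi h0]

lemma lintegral_Ioi_comp_mul (g : ℝ → ℝ≥0∞) {c : ℝ} (hc : 0 < c) :
    ∫⁻ y in Ioi (0 : ℝ), g y = ∫⁻ x in Ioi (0 : ℝ), ENNReal.ofReal c * g (c * x) := by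
  have himg : (fun x : ℝ => c * x) '' Ioi 0 = Ioi 0 := by
    rw [image_mul_left_Ioi hc, mul_zero]
  have := lintegral_image_eq_lintegral_abs_deriv_mul (f := fun x : ℝ => c * x)
    (f' := fun _ => c) (s := Ioi 0) measurableSet_Ioi
    (fun x _ => by simpa using ((hasDerivAt_id x).const_mul c).hasDerivWithinAt)
    (fun x _ y _ h => mul_left_cancel₀ hc.ne' h) g
  rwa [himg, abs_of_pos hc] at this

lemma lintegral_Ioi_comp_rpow (g : ℝ → ℝ≥0∞) {p : ℝ} (hp : p ≠ 0) :
    ∫⁻ y in Ioi (0 : ℝ), g y =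
      ∫⁻ x in Ioi (0 : ℝ), ENNReal.ofReal (|p| * x ^ (p - 1)) * g (x ^ p) := by
  have himg : (fun x : ℝ => x ^ p) '' Ioi 0 = Ioi 0 := by
    ext y
    constructor
    · rintro ⟨x, hx, rfl⟩
      exact rpow_pos_of_pos hx p
    · intro hy
      exact ⟨y ^ p⁻¹, rpow_pos_of_pos hy _, rpow_inv_rpow (le_of_lt hy) hp⟩
  have := lintegral_image_eq_lintegral_abs_deriv_mul (f := fun x : ℝ => x ^ p)
    (f' := fun x => p * x ^ (p - 1)) (s := Ioi 0) measurableSet_Ioi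
    (fun x hx => (hasDerivAt_rpow_const (Or.inl (ne_of_gt hx))).hasDerivWithinAt)
    (fun x hx y hy h => (rpow_left_inj (le_of_lt hx) (le_of_lt hy) hp).1 h) g
  rw [himg] at this
  rw [this]
  refine setLIntegral_congr_fun measurableSet_Ioi fun x hx => ?_
  simp only [abs_mul, abs_of_pos (rpow_pos_of_pos hx (p - 1))]

lemma lintegral_rpow_mul_exp_neg {s r : ℝ} (hs : 0 < s) (hr : 0 < r) :
    ∫⁻ x in Ioi (0 : ℝ), ENNReal.ofReal (x ^ (s - 1) * rexp (-(r * x))) =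
      ENNReal.ofReal (r ^ (-s) * Real.Gamma s) := by
  refine lintegral_ofReal_eq_of_integral_eq ?_ ?_
    (mul_pos (rpow_pos_of_pos hr _) (Real.Gamma_pos_of_pos hs))
  · filter_upwards [ae_restrict_mem measurableSet_Ioi] with x hx
    exact mul_nonneg (rpow_nonneg (le_of_lt hx) _) (exp_pos _).le
  · rw [Real.integral_rpow_mul_exp_neg_mul_Ioi hs hr, one_div, inv_rpow hr.le, rpow_neg hr.le]

lemma lintegral_rpow_mul_exp_neg_div {s A : ℝ} (hs : 0 < s) (hA : 0 < A) :
    ∫⁻ u in Ioi (0 : ℝ), ENNReal.ofReal (u ^ (-s - 1) * rexp (-(A / (4 * u)))) =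
      ENNReal.ofReal (4 ^ s * A ^ (-s) * Real.Gamma s) := by
  have h := lintegral_rpow_mul_exp_neg hs (div_pos hA four_pos)
  rw [lintegral_Ioi_comp_rpow _ (p := -1) (by norm_num)] at h
  rw [show (4 : ℝ) ^ s * A ^ (-s) = (A / 4) ^ (-s) by
    rw [div_rpow hA.le four_pos.le, rpow_neg four_pos.le, div_inv_eq_mul, mul_comm], ← h]
  refine setLIntegral_congr_fun measurableSet_Ioi fun x (hx : 0 < x) => ?_
  rw [← ENNReal.ofReal_mul (by positivity)]
  congr 1
  rw [← rpow_mul hx.le, ← mul_assoc, mul_assoc |(-1 : ℝ)|, ← rpow_add hx, abs_neg, abs_one,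
    one_mul]
  congr 2
  · ring
  · rw [rpow_neg_one]
    field_simp

/-- The Beta integral on the half line. -/
lemma lintegral_rpow_mul_one_add_rpow {α β : ℝ} (hα : 0 < α) (hβ : 0 < β) :
    ∫⁻ y in Ioi (0 : ℝ), ENNReal.ofReal (y ^ (α - 1) * (1 + y) ^ (-(α + β))) =
      ENNReal.ofReal (Real.Gamma α * Real.Gamma β / Real.Gamma (α + β)) := by
  have hG : 0 < Real.Gamma (α + β) := Real.Gamma_pos_of_pos (add_pos hα hβ)
  have key : ENNReal.ofReal (Real.Gamma (α + β)) *
      ∫⁻ y in Ioi (0 : ℝ), ENNReal.ofReal (y ^ (α - 1) * (1 + y) ^ (-(α + β))) =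
      ENNReal.ofReal (Real.Gamma α * Real.Gamma β) := by
    calc _ = ∫⁻ y in Ioi (0 : ℝ), ∫⁻ r in Ioi (0 : ℝ),
          ENNReal.ofReal (y ^ (α - 1) * (r ^ (α + β - 1) * rexp (-((1 + y) * r)))) := by
          rw [← lintegral_const_mul _ (by fun_prop)]
          refine setLIntegral_congr_fun measurableSet_Ioi fun y (hy : 0 < y) => ?_
          have hy1 : 0 ≤ y ^ (α - 1) := rpow_nonneg hy.le _
          simp only [ENNReal.ofReal_mul hy1]
          rw [lintegral_const_mul _ (by fun_prop),
            lintegral_rpow_mul_exp_neg (add_pos hα hβ) (by positivity),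
            ← ENNReal.ofReal_mul hy1, ← ENNReal.ofReal_mul hy1, ← ENNReal.ofReal_mul hG.le]
          congr 1
          ring
      _ = ∫⁻ r in Ioi (0 : ℝ), ∫⁻ y in Ioi (0 : ℝ),
          ENNReal.ofReal (y ^ (α - 1) * (r ^ (α + β - 1) * rexp (-((1 + y) * r)))) :=
          lintegral_lintegral_swap (by fun_prop)
      _ = ∫⁻ r in Ioi (0 : ℝ), ENNReal.ofReal (Real.Gamma α) *
            ENNReal.ofReal (r ^ (β - 1) * rexp (-(1 * r))) := by
          refine setLIntegral_congr_fun measurableSet_Ioi fun r (hr : 0 < r) => ?_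
          have : ∀ y : ℝ, ENNReal.ofReal
              (y ^ (α - 1) * (r ^ (α + β - 1) * rexp (-((1 + y) * r)))) =
              ENNReal.ofReal (r ^ (α + β - 1) * rexp (-r)) *
                ENNReal.ofReal (y ^ (α - 1) * rexp (-(r * y))) := fun y => by
            rw [← ENNReal.ofReal_mul (by positivity)]
            congr 1
            rw [show -((1 + y) * r) = -r + -(r * y) by ring, exp_add]
            ring
          simp only [this]
          rw [lintegral_const_mul _ (by fun_prop), lintegral_rpow_mul_exp_neg hα hr,
            ← ENNReal.ofReal_mul (by positivity),
            ← ENNReal.ofReal_mul (Real.Gamma_pos_of_pos hα).le]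
          congr 1
          rw [one_mul, show β - 1 = (α + β - 1) + -α by ring, rpow_add hr]
          ring
      _ = _ := by
          rw [lintegral_const_mul _ (by fun_prop), lintegral_rpow_mul_exp_neg hβ one_pos,
            ← ENNReal.ofReal_mul (Real.Gamma_pos_of_pos hα).le, one_rpow, one_mul]
  rw [ENNReal.ofReal_div_of_pos hG, ← key, mul_comm, ENNReal.mul_div_cancel_right]
  · simpa using hG
  · exact ENNReal.ofReal_ne_top

lemma lintegral_lintegral_lintegral_rotate {α β δ : Type*} [MeasurableSpace α] [MeasurableSpace β]
    [MeasurableSpace δ] {μ : Measure α} {ν : Measure β} {κ : Measure δ} [SFinite μ] [SFinite ν]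
    [SFinite κ] {F : α → β → δ → ℝ≥0∞}
    (hF : Measurable fun q : α × β × δ => F q.1 q.2.1 q.2.2) :
    ∫⁻ x, ∫⁻ y, ∫⁻ z, F x y z ∂κ ∂ν ∂μ = ∫⁻ y, ∫⁻ z, ∫⁻ x, F x y z ∂μ ∂κ ∂ν := by
  rw [lintegral_lintegral_swap]
  · refine lintegral_congr fun y => ?_
    rw [lintegral_lintegral_swap]
    have : Measurable fun q : α × δ => F q.1 y q.2 :=
      hF.comp (measurable_fst.prodMk (measurable_const.prodMk measurable_snd))
    exact this.aemeasurable
  · have h : Measurable fun q : (α × β) × δ => F q.1.1 q.1.2 q.2 :=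
      hF.comp ((measurable_fst.comp measurable_fst).prodMk
        ((measurable_snd.comp measurable_fst).prodMk measurable_snd))
    exact h.lintegral_prod_right'.aemeasurable

/-! ### The Laplace-type integral representing the Bessel functions -/

/-- `∫_0^∞ v^{a-1} e^{-1/(4v)} e^{-zv} dv`, a multiple of `z^{-a/2} K_a(√z)`. -/
def besselLaplace (a z : ℝ) : ℝ≥0∞ :=
  ∫⁻ v in Ioi (0 : ℝ), ENNReal.ofReal (v ^ (a - 1) * rexp (-(1 / (4 * v))) * rexp (-(z * v)))

lemma measurable_besselLaplace (a : ℝ) : Measurable (besselLaplace a) := by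
  have h : Measurable fun q : ℝ × ℝ =>
      ENNReal.ofReal (q.2 ^ (a - 1) * rexp (-(1 / (4 * q.2))) * rexp (-(q.1 * q.2))) := by
    fun_prop
  exact h.lintegral_prod_right'

lemma besselLaplace_mul (a b z : ℝ) :
    besselLaplace a z * besselLaplace b z = ∫⁻ v in Ioi (0 : ℝ), ∫⁻ w in Ioi (0 : ℝ),
      ENNReal.ofReal (v ^ (a - 1) * rexp (-(1 / (4 * v))) * rexp (-(z * v))) *
        ENNReal.ofReal (w ^ (b - 1) * rexp (-(1 / (4 * w))) * rexp (-(z * w))) := by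
  rw [besselLaplace, besselLaplace, lintegral_lintegral_mul (by fun_prop) (by fun_prop)]

/-- The value of `∫_0^∞ z^{p-1} L_a(z) L_b(z) dz`, with `L_a` the function `besselLaplace a`. -/
def besselMoment (a b p : ℝ) : ℝ :=
  4 ^ (p - a - b) * (Real.Gamma p * Real.Gamma (p - a - b) *
    (Real.Gamma (p - a) * Real.Gamma (p - b) / Real.Gamma (2 * p - a - b)))

lemma lintegral_rpow_mul_besselLaplace_mul {a b p : ℝ} (hp : 0 < p) (hab : 0 < p - a - b)
    (ha : 0 < p - a) (hb : 0 < p - b) :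
    ∫⁻ z in Ioi (0 : ℝ), ENNReal.ofReal (z ^ (p - 1)) * (besselLaplace a z * besselLaplace b z) =
      ENNReal.ofReal (besselMoment a b p) := by
  set s := p - a - b with hs
  have hGp := Real.Gamma_pos_of_pos hp
  have hGs := Real.Gamma_pos_of_pos hab
  calc
    _ = ∫⁻ z in Ioi (0 : ℝ), ∫⁻ v in Ioi (0 : ℝ), ∫⁻ w in Ioi (0 : ℝ),
          ENNReal.ofReal (z ^ (p - 1)) *
            (ENNReal.ofReal (v ^ (a - 1) * rexp (-(1 / (4 * v))) * rexp (-(z * v))) *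
            ENNReal.ofReal (w ^ (b - 1) * rexp (-(1 / (4 * w))) * rexp (-(z * w)))) := by
        refine lintegral_congr fun z => ?_
        rw [besselLaplace_mul, ← lintegral_const_mul' _ _ ENNReal.ofReal_ne_top]
        refine lintegral_congr fun v => ?_
        rw [← lintegral_const_mul' _ _ ENNReal.ofReal_ne_top]
    _ = ∫⁻ v in Ioi (0 : ℝ), ∫⁻ w in Ioi (0 : ℝ), ∫⁻ z in Ioi (0 : ℝ),
          ENNReal.ofReal (z ^ (p - 1)) *
            (ENNReal.ofReal (v ^ (a - 1) * rexp (-(1 / (4 * v))) * rexp (-(z * v))) *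
            ENNReal.ofReal (w ^ (b - 1) * rexp (-(1 / (4 * w))) * rexp (-(z * w)))) :=
        lintegral_lintegral_lintegral_rotate (by fun_prop)
    _ = ∫⁻ v in Ioi (0 : ℝ), ∫⁻ w in Ioi (0 : ℝ), ENNReal.ofReal (Real.Gamma p *
          (v ^ (a - 1) * rexp (-(1 / (4 * v))) * (w ^ (b - 1) * rexp (-(1 / (4 * w)))) *
            (v + w) ^ (-p))) := by
        refine setLIntegral_congr_fun measurableSet_Ioi fun v (hv : 0 < v) => ?_
        refine setLIntegral_congr_fun measurableSet_Ioi fun w (hw : 0 < w) => ?_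
        have hk : 0 ≤ v ^ (a - 1) * rexp (-(1 / (4 * v))) *
          (w ^ (b - 1) * rexp (-(1 / (4 * w)))) := by positivity
        have h : ∀ z ∈ Ioi (0 : ℝ), ENNReal.ofReal (z ^ (p - 1)) *
            (ENNReal.ofReal (v ^ (a - 1) * rexp (-(1 / (4 * v))) * rexp (-(z * v))) *
            ENNReal.ofReal (w ^ (b - 1) * rexp (-(1 / (4 * w))) * rexp (-(z * w)))) =
            ENNReal.ofReal (v ^ (a - 1) * rexp (-(1 / (4 * v))) *
              (w ^ (b - 1) * rexp (-(1 / (4 * w))))) *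
              ENNReal.ofReal (z ^ (p - 1) * rexp (-((v + w) * z))) := by
          intro z (hz : 0 < z)
          rw [← ENNReal.ofReal_mul (by positivity), ← ENNReal.ofReal_mul (by positivity),
            ← ENNReal.ofReal_mul (by positivity)]
          congr 1
          rw [show -((v + w) * z) = -(z * v) + -(z * w) by ring, exp_add]
          ring
        rw [setLIntegral_congr_fun measurableSet_Ioi h, lintegral_const_mul _ (by fun_prop),
          lintegral_rpow_mul_exp_neg hp (add_pos hv hw), ← ENNReal.ofReal_mul hk]
        congr 1
        ring
    _ = ∫⁻ v in Ioi (0 : ℝ), ∫⁻ y in Ioi (0 : ℝ), ENNReal.ofReal (Real.Gamma p *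
          (y ^ (b - 1) * (1 + y) ^ (-p) *
            (v ^ (-s - 1) * rexp (-(((1 + y) / y) / (4 * v)))))) := by
        refine setLIntegral_congr_fun measurableSet_Ioi fun v (hv : 0 < v) => ?_
        rw [lintegral_Ioi_comp_mul _ hv]
        refine setLIntegral_congr_fun measurableSet_Ioi fun y (hy : 0 < y) => ?_
        rw [← ENNReal.ofReal_mul hv.le]
        congr 1
        rw [show v + v * y = v * (1 + y) by ring, mul_rpow hv.le (by positivity : 0 ≤ 1 + y),
          mul_rpow hv.le hy.le, show -((1 + y) / y / (4 * v)) =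
            -(1 / (4 * v)) + -(1 / (4 * (v * y))) by field_simp; ring, exp_add,
          show -s - 1 = 1 + ((a - 1) + ((b - 1) + -p)) by rw [hs]; ring, rpow_add hv,
          rpow_add hv, rpow_add hv, rpow_one]
        ring
    _ = ∫⁻ y in Ioi (0 : ℝ), ∫⁻ v in Ioi (0 : ℝ), ENNReal.ofReal (Real.Gamma p *
          (y ^ (b - 1) * (1 + y) ^ (-p) *
            (v ^ (-s - 1) * rexp (-(((1 + y) / y) / (4 * v)))))) :=
        lintegral_lintegral_swap (by fun_prop)
    _ = ∫⁻ y in Ioi (0 : ℝ), ENNReal.ofReal (4 ^ s * (Real.Gamma p * Real.Gamma s)) *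
          ENNReal.ofReal (y ^ (p - a - 1) * (1 + y) ^ (-((p - a) + (p - b)))) := by
        refine setLIntegral_congr_fun measurableSet_Ioi fun y (hy : 0 < y) => ?_
        have hk : 0 ≤ Real.Gamma p * (y ^ (b - 1) * (1 + y) ^ (-p)) := by positivity
        have h1 : 0 < 1 + y := by positivity
        simp only [← mul_assoc (Real.Gamma p) (y ^ (b - 1) * (1 + y) ^ (-p)), ENNReal.ofReal_mul hk]
        rw [lintegral_const_mul _ (by fun_prop),
          lintegral_rpow_mul_exp_neg_div hab (by positivity), ← ENNReal.ofReal_mul (by positivity),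
          ← ENNReal.ofReal_mul (by positivity)]
        congr 1
        rw [div_rpow h1.le hy.le, rpow_neg hy.le s, div_inv_eq_mul,
          show p - a - 1 = (b - 1) + s by rw [hs]; ring,
          show -(p - a + (p - b)) = -p + -s by rw [hs]; ring, rpow_add hy, rpow_add h1]
        ring
    _ = _ := by
        rw [lintegral_const_mul _ (by fun_prop), lintegral_rpow_mul_one_add_rpow ha hb,
          ← ENNReal.ofReal_mul (by positivity), besselMoment,
          show 2 * p - a - b = p - a + (p - b) by ring]
        congr 1
        ring

lemma besselMoment_pos {a b p : ℝ} (hp : 0 < p) (hab : 0 < p - a - b)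
    (ha : 0 < p - a) (hb : 0 < p - b) : 0 < besselMoment a b p := by
  have := Real.Gamma_pos_of_pos hp
  have := Real.Gamma_pos_of_pos hab
  have := Real.Gamma_pos_of_pos ha
  have := Real.Gamma_pos_of_pos hb
  have := Real.Gamma_pos_of_pos (s := 2 * p - a - b) (by linarith)
  unfold besselMoment
  positivity

/-! ### Gaussian integrals on Euclidean space -/

lemma lintegral_gaussian_mul_gaussian (n : ℕ) (x : EuclideanSpace ℝ (Fin n)) {u v : ℝ}
    (hu : 0 < u) (hv : 0 < v) :
    ∫⁻ ξ : EuclideanSpace ℝ (Fin n),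
        ENNReal.ofReal (rexp (-(‖x - ξ‖ ^ 2 / (4 * v))) * rexp (-(‖ξ‖ ^ 2 / (4 * u)))) =
      ENNReal.ofReal ((4 * π) ^ ((n : ℝ) / 2) * ((u * v) ^ ((n : ℝ) / 2) *
        ((u + v) ^ (-((n : ℝ) / 2)) * rexp (-(‖x‖ ^ 2 / (4 * (u + v))))))) := by
  have hs : 0 < u + v := add_pos hu hv
  have hb : 0 < (u + v) / (4 * u * v) := by positivity
  refine lintegral_ofReal_eq_of_integral_eq (Eventually.of_forall fun ξ => by positivity) ?_
    (by positivity)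
  have h : ∀ ξ : EuclideanSpace ℝ (Fin n),
      rexp (-(‖x - ξ‖ ^ 2 / (4 * v))) * rexp (-(‖ξ‖ ^ 2 / (4 * u))) =
        rexp (-(‖x‖ ^ 2 / (4 * (u + v)))) *
          rexp (-((u + v) / (4 * u * v)) * ‖ξ - (u / (u + v)) • x‖ ^ 2) := by
    intro ξ
    rw [← exp_add, ← exp_add]
    congr 1
    rw [norm_sub_sq_real, norm_sub_sq_real, inner_smul_right, norm_smul, mul_pow,
      real_inner_comm, norm_eq_abs, sq_abs]
    field_simp
    ring
  simp_rw [h]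
  rw [integral_const_mul, integral_sub_right_eq_self
      (fun ξ : EuclideanSpace ℝ (Fin n) => rexp (-((u + v) / (4 * u * v)) * ‖ξ‖ ^ 2)),
    GaussianFourier.integral_rexp_neg_mul_sq_norm hb, finrank_euclideanSpace, Fintype.card_fin,
    show π / ((u + v) / (4 * u * v)) = (4 * π) * (u * v) / (u + v) by field_simp,
    div_rpow (by positivity) hs.le, mul_rpow (by positivity) (by positivity), rpow_neg hs.le,
    div_eq_mul_inv]
  ring

lemma lintegral_norm_pow_four_mul_gaussian {n : ℕ} (hn : 0 < n) {α : ℝ} (hα : 0 < α) :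
    ∫⁻ x : EuclideanSpace ℝ (Fin n), ENNReal.ofReal (‖x‖ ^ 4 * rexp (-(α * ‖x‖ ^ 2))) =
      ENNReal.ofReal ((π / α) ^ ((n : ℝ) / 2) * ((n : ℝ) * (n + 2) / (4 * α ^ 2))) := by
  have hn' : (0 : ℝ) < n := by exact_mod_cast hn
  have : Nontrivial (EuclideanSpace ℝ (Fin n)) := by
    have : Nonempty (Fin n) := ⟨⟨0, hn⟩⟩
    infer_instance
  refine lintegral_ofReal_eq_of_integral_eq (Eventually.of_forall fun ξ => by positivity) ?_
    (by positivity)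
  have h0 := integral_fun_norm_addHaar (volume : Measure (EuclideanSpace ℝ (Fin n)))
    (fun r => rexp (-α * r ^ 2))
  have h4 := integral_fun_norm_addHaar (volume : Measure (EuclideanSpace ℝ (Fin n)))
    (fun r => r ^ 4 * rexp (-(α * r ^ 2)))
  rw [GaussianFourier.integral_rexp_neg_mul_sq_norm hα, finrank_euclideanSpace,
    Fintype.card_fin] at h0
  rw [h4, h0, finrank_euclideanSpace, Fintype.card_fin]
  have e0 : ∫ y in Ioi (0 : ℝ), y ^ (n - 1) • rexp (-α * y ^ 2) =
      α ^ (-((n : ℝ) / 2)) * (1 / 2) * Real.Gamma ((n : ℝ) / 2) := by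
    have := integral_rpow_mul_exp_neg_mul_rpow (p := 2) (q := (n : ℝ) - 1) (b := α) (by norm_num)
      (by linarith) hα
    rw [show -((n : ℝ) - 1 + 1) / 2 = -((n : ℝ) / 2) by ring,
      show ((n : ℝ) - 1 + 1) / 2 = (n : ℝ) / 2 by ring] at this
    rw [← this]
    refine setIntegral_congr_fun measurableSet_Ioi fun y (hy : 0 < y) => ?_
    simp only [smul_eq_mul]
    rw [← rpow_natCast, Nat.cast_sub hn, Nat.cast_one, rpow_two]
  have e4 : ∫ y in Ioi (0 : ℝ), y ^ (n - 1) • (y ^ 4 * rexp (-(α * y ^ 2))) =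
      α ^ (-((n : ℝ) / 2 + 2)) * (1 / 2) * Real.Gamma ((n : ℝ) / 2 + 2) := by
    have := integral_rpow_mul_exp_neg_mul_rpow (p := 2) (q := (n : ℝ) + 3) (b := α) (by norm_num)
      (by linarith) hα
    rw [show -((n : ℝ) + 3 + 1) / 2 = -((n : ℝ) / 2 + 2) by ring,
      show ((n : ℝ) + 3 + 1) / 2 = (n : ℝ) / 2 + 2 by ring] at this
    rw [← this]
    refine setIntegral_congr_fun measurableSet_Ioi fun y (hy : 0 < y) => ?_
    simp only [smul_eq_mul]
    rw [← mul_assoc, ← pow_add, ← rpow_natCast, rpow_two, neg_mul,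
      show n - 1 + 4 = n + 3 by omega]
    push_cast
    rfl
  rw [e0, e4, show (n : ℝ) / 2 + 2 = ((n : ℝ) / 2 + 1) + 1 by ring,
    Real.Gamma_add_one (by positivity), Real.Gamma_add_one (by positivity), neg_add, neg_add,
    rpow_add hα, rpow_add hα, rpow_neg_one]
  simp only [nsmul_eq_mul, smul_eq_mul]
  field_simp
  ring

lemma lintegral_mul_sq_lintegral {X Ω : Type*} [MeasurableSpace X] [MeasurableSpace Ω]
    {μ : Measure X} {ν : Measure Ω} [SFinite μ] [SFinite ν] {f : X → ℝ≥0∞} {e : X → Ω → ℝ≥0∞}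
    (hf : Measurable f) (he : Measurable (Function.uncurry e)) :
    ∫⁻ x, f x * (∫⁻ ω, e x ω ∂ν) ^ 2 ∂μ =
      ∫⁻ ω, ∫⁻ ω', ∫⁻ x, f x * (e x ω * e x ω') ∂μ ∂ν ∂ν := by
  rw [← lintegral_lintegral_lintegral_rotate]
  · refine lintegral_congr fun x => ?_
    have hx : Measurable (e x) := he.comp measurable_prodMk_left
    rw [sq, ← lintegral_lintegral_mul hx.aemeasurable hx.aemeasurable, ← lintegral_const_mul]
    · refine lintegral_congr fun ω => ?_
      rw [← lintegral_const_mul]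
      fun_prop
    · have : Measurable fun q : Ω × Ω => e x q.1 * e x q.2 := by fun_prop
      exact this.lintegral_prod_right'
  · have h1 : Measurable fun q : X × Ω × Ω => e q.1 q.2.1 :=
      he.comp (measurable_fst.prodMk (measurable_fst.comp measurable_snd))
    have h2 : Measurable fun q : X × Ω × Ω => e q.1 q.2.2 :=
      he.comp (measurable_fst.prodMk (measurable_snd.comp measurable_snd))
    fun_prop

/-- Plancherel-type identity for mixtures of centred Gaussians. -/
lemma lintegral_norm_pow_four_mul_sq_gaussian_mixture {n : ℕ} (hn : 0 < n) {Ω : Type*}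
    [MeasurableSpace Ω] {ν : Measure Ω} [SFinite ν] {P : Ω → ℝ} (hP : Measurable P)
    (hpos : ∀ᵐ ω ∂ν, 0 < P ω) :
    ∫⁻ x : EuclideanSpace ℝ (Fin n), ENNReal.ofReal (‖x‖ ^ 4) *
        (∫⁻ ω, ENNReal.ofReal (P ω ^ (-((n : ℝ) / 2)) * rexp (-(‖x‖ ^ 2 / (4 * P ω)))) ∂ν) ^ 2 =
      ENNReal.ofReal ((4 * π) ^ ((n : ℝ) / 2) * (4 * n * (n + 2)) /
          Real.Gamma ((n : ℝ) / 2 + 2)) *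
        ∫⁻ τ in Ioi (0 : ℝ), ENNReal.ofReal (τ ^ ((n : ℝ) / 2 + 1)) *
          (∫⁻ ω, ENNReal.ofReal (P ω ^ 2 * rexp (-(τ * P ω))) ∂ν) ^ 2 := by
  have hG : 0 < Real.Gamma ((n : ℝ) / 2 + 2) := Real.Gamma_pos_of_pos (by positivity)
  rw [lintegral_mul_sq_lintegral (by fun_prop) (by unfold Function.uncurry; fun_prop),
    lintegral_mul_sq_lintegral (by fun_prop) (by unfold Function.uncurry; fun_prop),
    ← lintegral_const_mul' _ _ ENNReal.ofReal_ne_top]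
  refine lintegral_congr_ae ?_
  filter_upwards [hpos] with ω hp
  rw [← lintegral_const_mul' _ _ ENNReal.ofReal_ne_top]
  refine lintegral_congr_ae ?_
  filter_upwards [hpos] with ω' hq
  set p := P ω
  set q := P ω'
  have hpq : 0 < p + q := add_pos hp hq
  have hL : ∀ x : EuclideanSpace ℝ (Fin n), ENNReal.ofReal (‖x‖ ^ 4) *
      (ENNReal.ofReal (p ^ (-((n : ℝ) / 2)) * rexp (-(‖x‖ ^ 2 / (4 * p)))) *
        ENNReal.ofReal (q ^ (-((n : ℝ) / 2)) * rexp (-(‖x‖ ^ 2 / (4 * q))))) =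
      ENNReal.ofReal ((p * q) ^ (-((n : ℝ) / 2))) *
        ENNReal.ofReal (‖x‖ ^ 4 * rexp (-((p + q) / (4 * p * q) * ‖x‖ ^ 2))) := by
    intro x
    rw [← ENNReal.ofReal_mul (by positivity), ← ENNReal.ofReal_mul (by positivity),
      ← ENNReal.ofReal_mul (by positivity)]
    congr 1
    rw [show -((p + q) / (4 * p * q) * ‖x‖ ^ 2) = -(‖x‖ ^ 2 / (4 * p)) + -(‖x‖ ^ 2 / (4 * q)) by
      field_simp; ring, exp_add, mul_rpow hp.le hq.le]
    ring
  have hR : ∀ τ ∈ Ioi (0 : ℝ), ENNReal.ofReal (τ ^ ((n : ℝ) / 2 + 1)) *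
      (ENNReal.ofReal (p ^ 2 * rexp (-(τ * p))) * ENNReal.ofReal (q ^ 2 * rexp (-(τ * q)))) =
      ENNReal.ofReal ((p * q) ^ 2) *
        ENNReal.ofReal (τ ^ ((n : ℝ) / 2 + 2 - 1) * rexp (-((p + q) * τ))) := by
    intro τ (hτ : 0 < τ)
    rw [← ENNReal.ofReal_mul (by positivity), ← ENNReal.ofReal_mul (by positivity),
      ← ENNReal.ofReal_mul (by positivity)]
    congr 1
    rw [show -((p + q) * τ) = -(τ * p) + -(τ * q) by ring, exp_add,
      show (n : ℝ) / 2 + 2 - 1 = (n : ℝ) / 2 + 1 by ring]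
    ring
  rw [lintegral_congr hL, setLIntegral_congr_fun measurableSet_Ioi hR,
    lintegral_const_mul _ (by fun_prop), lintegral_const_mul _ (by fun_prop),
    lintegral_norm_pow_four_mul_gaussian hn (by positivity),
    lintegral_rpow_mul_exp_neg (by positivity) hpq, ← ENNReal.ofReal_mul (by positivity),
    ← ENNReal.ofReal_mul (by positivity), ← ENNReal.ofReal_mul (by positivity)]
  congr 1
  rw [show π / ((p + q) / (4 * p * q)) = (4 * π) * (p * q) / (p + q) by field_simp,
    div_rpow (by positivity) hpq.le, rpow_neg (by positivity : 0 ≤ p * q),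
    mul_rpow (by positivity : 0 ≤ 4 * π) (by positivity : 0 ≤ p * q), neg_add, rpow_add hpq,
    rpow_neg hpq.le, rpow_neg hpq.le, rpow_two]
  field_simp

/-! ### The extension of the bubble as a mixture of Gaussians -/

/-- The density of the mixing measure of the extension at height `t`. -/
def mixDensity (γ t : ℝ) (ω : ℝ × ℝ) : ℝ :=
  ω.1 ^ (γ - 1) * rexp (-(1 / (4 * ω.1))) * (ω.2 ^ (-γ - 1) * rexp (-(t ^ 2 / (4 * ω.2))))

lemma measurable_mixDensity (γ t : ℝ) : Measurable (mixDensity γ t) := by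
  unfold mixDensity
  fun_prop

/-- The mixing measure on pairs of variances. -/
def mixMeasure (γ t : ℝ) : Measure (ℝ × ℝ) :=
  ((volume.restrict (Ioi (0 : ℝ))).prod (volume.restrict (Ioi (0 : ℝ)))).withDensity
    fun ω => ENNReal.ofReal (mixDensity γ t ω)

instance (γ t : ℝ) : SFinite (mixMeasure γ t) := by
  unfold mixMeasure
  infer_instance

lemma lintegral_mixMeasure (γ t : ℝ) {F : ℝ × ℝ → ℝ≥0∞} (hF : Measurable F) :
    ∫⁻ ω, F ω ∂(mixMeasure γ t) = ∫⁻ u in Ioi (0 : ℝ), ∫⁻ v in Ioi (0 : ℝ),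
      ENNReal.ofReal (mixDensity γ t (u, v)) * F (u, v) := by
  have hm := (measurable_mixDensity γ t).ennreal_ofReal
  rw [mixMeasure, lintegral_withDensity_eq_lintegral_mul _ hm hF,
    lintegral_prod _ (hm.mul hF).aemeasurable]
  rfl

lemma ae_mixMeasure_pos (γ t : ℝ) : ∀ᵐ ω ∂(mixMeasure γ t), 0 < ω.1 + ω.2 := by
  refine (withDensity_absolutelyContinuous _ _).ae_le ?_
  rw [Measure.prod_restrict]
  filter_upwards [ae_restrict_mem (measurableSet_Ioi.prod measurableSet_Ioi)] with ω hω
  exact add_pos hω.1 hω.2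

/-- The Poisson integrand of the extension of the standard bubble, without `p_{n,γ}`. -/
def extIntegrand (n : ℕ) (γ : ℝ) (x : EuclideanSpace ℝ (Fin n)) (t : ℝ)
    (ξ : EuclideanSpace ℝ (Fin n)) : ℝ :=
  t ^ (2 * γ) / (‖x - ξ‖ ^ 2 + t ^ 2) ^ (((n : ℝ) + 2 * γ) / 2) * bubble n γ 1 0 ξ

/-- The constant relating the extension to a mixture of Gaussians. -/
def extConst (n : ℕ) (γ : ℝ) : ℝ :=
  cng n γ * (4 ^ (-(n : ℝ)) / (Real.Gamma (((n : ℝ) - 2 * γ) / 2) *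
    Real.Gamma (((n : ℝ) + 2 * γ) / 2))) * (4 * π) ^ ((n : ℝ) / 2)

lemma cng_pos {n : ℕ} {γ : ℝ} (hγ : 0 < γ) (hn : 2 * γ < n) : 0 < cng n γ := by
  have := Real.Gamma_pos_of_pos (s := ((n : ℝ) - 2 * γ) / 2) (by linarith)
  have := Real.Gamma_pos_of_pos (s := ((n : ℝ) + 2 * γ) / 2) (by linarith)
  unfold cng
  positivity

lemma extConst_pos {n : ℕ} {γ : ℝ} (hγ : 0 < γ) (hn : 2 * γ < n) : 0 < extConst n γ := by
  have := Real.Gamma_pos_of_pos (s := ((n : ℝ) - 2 * γ) / 2) (by linarith)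
  have := Real.Gamma_pos_of_pos (s := ((n : ℝ) + 2 * γ) / 2) (by linarith)
  have := cng_pos hγ hn
  unfold extConst
  positivity

lemma extIntegrand_nonneg {n : ℕ} {γ : ℝ} (hγ : 0 < γ) (hn : 2 * γ < n)
    (x : EuclideanSpace ℝ (Fin n)) {t : ℝ} (ht : 0 < t) (ξ : EuclideanSpace ℝ (Fin n)) :
    0 ≤ extIntegrand n γ x t ξ := by
  have := cng_pos hγ hn
  unfold extIntegrand bubble
  positivity

lemma lintegral_extIntegrand {n : ℕ} {γ : ℝ} (hγ : 0 < γ) (hn : 2 * γ < n)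
    (x : EuclideanSpace ℝ (Fin n)) {t : ℝ} (ht : 0 < t) :
    ∫⁻ ξ, ENNReal.ofReal (extIntegrand n γ x t ξ) =
      ENNReal.ofReal (extConst n γ * t ^ (2 * γ)) *
        ∫⁻ ω, ENNReal.ofReal ((ω.1 + ω.2) ^ (-((n : ℝ) / 2)) *
          rexp (-(‖x‖ ^ 2 / (4 * (ω.1 + ω.2))))) ∂(mixMeasure γ t) := by
  set a := ((n : ℝ) - 2 * γ) / 2 with ha
  set b := ((n : ℝ) + 2 * γ) / 2 with hb
  have ha0 : 0 < a := by rw [ha]; linarith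
  have hb0 : 0 < b := by rw [hb]; linarith
  have hGa := Real.Gamma_pos_of_pos ha0
  have hGb := Real.Gamma_pos_of_pos hb0
  have hc := cng_pos hγ hn
  set K := cng n γ * t ^ (2 * γ) * (4 ^ (-(n : ℝ)) / (Real.Gamma a * Real.Gamma b)) with hK
  have hK0 : 0 ≤ K := by positivity
  have h4 : (4 : ℝ) ^ (-(n : ℝ)) * (4 ^ a * 4 ^ b) = 1 := by
    rw [← rpow_add four_pos, ← rpow_add four_pos, show -(n : ℝ) + (a + b) = 0 by
      rw [ha, hb]; ring, rpow_zero]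
  calc
    _ = ∫⁻ ξ : EuclideanSpace ℝ (Fin n), ENNReal.ofReal K *
          ∫⁻ u in Ioi (0 : ℝ), ∫⁻ v in Ioi (0 : ℝ),
          ENNReal.ofReal (u ^ (-a - 1) * rexp (-((1 + ‖ξ‖ ^ 2) / (4 * u)))) *
          ENNReal.ofReal (v ^ (-b - 1) * rexp (-((‖x - ξ‖ ^ 2 + t ^ 2) / (4 * v)))) := by
        refine lintegral_congr fun ξ => ?_
        rw [lintegral_lintegral_mul (by fun_prop) (by fun_prop),
          lintegral_rpow_mul_exp_neg_div ha0 (by positivity),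
          lintegral_rpow_mul_exp_neg_div hb0 (by positivity), ← ENNReal.ofReal_mul (by positivity),
          ← ENNReal.ofReal_mul (by positivity)]
        congr 1
        rw [extIntegrand, bubble, sub_zero, one_pow, one_div, inv_rpow (by positivity),
          ← rpow_neg (by positivity), ← ha, ← hb, rpow_neg (by positivity) b, div_eq_mul_inv]
        calc _ = cng n γ * t ^ (2 * γ) * ((1 + ‖ξ‖ ^ 2) ^ (-a) *
              ((‖x - ξ‖ ^ 2 + t ^ 2) ^ b)⁻¹) * (4 ^ (-(n : ℝ)) * (4 ^ a * 4 ^ b)) := by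
              rw [h4]; ring
          _ = _ := by rw [hK]; field_simp
    _ = ENNReal.ofReal K * ∫⁻ u in Ioi (0 : ℝ), ∫⁻ v in Ioi (0 : ℝ),
          ∫⁻ ξ : EuclideanSpace ℝ (Fin n),
          ENNReal.ofReal (u ^ (-a - 1) * rexp (-((1 + ‖ξ‖ ^ 2) / (4 * u)))) *
          ENNReal.ofReal (v ^ (-b - 1) * rexp (-((‖x - ξ‖ ^ 2 + t ^ 2) / (4 * v)))) := by
        rw [lintegral_const_mul' _ _ ENNReal.ofReal_ne_top,
          lintegral_lintegral_lintegral_rotate (by fun_prop)]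
    _ = ENNReal.ofReal K * ∫⁻ u in Ioi (0 : ℝ), ∫⁻ v in Ioi (0 : ℝ),
          ENNReal.ofReal ((4 * π) ^ ((n : ℝ) / 2)) *
          (ENNReal.ofReal (mixDensity γ t (u, v)) *
          ENNReal.ofReal ((u + v) ^ (-((n : ℝ) / 2)) * rexp (-(‖x‖ ^ 2 / (4 * (u + v)))))) := by
        congr 1
        refine setLIntegral_congr_fun measurableSet_Ioi fun u (hu : 0 < u) => ?_
        refine setLIntegral_congr_fun measurableSet_Ioi fun v (hv : 0 < v) => ?_
        have h : ∀ ξ : EuclideanSpace ℝ (Fin n),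
            ENNReal.ofReal (u ^ (-a - 1) * rexp (-((1 + ‖ξ‖ ^ 2) / (4 * u)))) *
            ENNReal.ofReal (v ^ (-b - 1) * rexp (-((‖x - ξ‖ ^ 2 + t ^ 2) / (4 * v)))) =
            ENNReal.ofReal (u ^ (-a - 1) * rexp (-(1 / (4 * u))) *
              (v ^ (-b - 1) * rexp (-(t ^ 2 / (4 * v))))) *
            ENNReal.ofReal (rexp (-(‖x - ξ‖ ^ 2 / (4 * v))) * rexp (-(‖ξ‖ ^ 2 / (4 * u)))) := by
          intro ξ
          rw [← ENNReal.ofReal_mul (by positivity), ← ENNReal.ofReal_mul (by positivity)]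
          congr 1
          rw [add_div, add_div, neg_add, neg_add, exp_add, exp_add]
          ring
        simp only [h]
        rw [lintegral_const_mul _ (by fun_prop), lintegral_gaussian_mul_gaussian n x hu hv,
          mixDensity, ← ENNReal.ofReal_mul (by positivity), ← ENNReal.ofReal_mul (by positivity),
          ← ENNReal.ofReal_mul (by positivity)]
        congr 1
        rw [mul_rpow hu.le hv.le, show -a - 1 = (γ - 1) - (n : ℝ) / 2 by rw [ha]; ring,
          show -b - 1 = (-γ - 1) - (n : ℝ) / 2 by rw [hb]; ring, rpow_sub hu, rpow_sub hv]
        field_simp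
    _ = _ := by
        rw [lintegral_mixMeasure _ _ (by fun_prop)]
        simp only [lintegral_const_mul' _ _ ENNReal.ofReal_ne_top]
        rw [← mul_assoc, ← ENNReal.ofReal_mul hK0]
        congr 2
        rw [hK, extConst, ← ha, ← hb]
        ring

lemma lintegral_scaled_besselLaplace (a : ℝ) (τ : ℝ) {t : ℝ} (ht : 0 < t) :
    ∫⁻ v in Ioi (0 : ℝ),
        ENNReal.ofReal (v ^ (a - 1) * rexp (-(t ^ 2 / (4 * v))) * rexp (-(τ * v))) =
      ENNReal.ofReal (t ^ (2 * a)) * besselLaplace a (τ * t ^ 2) := by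
  have ht2 : 0 < t ^ 2 := by positivity
  rw [lintegral_Ioi_comp_mul _ ht2, besselLaplace, ← lintegral_const_mul' _ _ ENNReal.ofReal_ne_top]
  refine setLIntegral_congr_fun measurableSet_Ioi fun v (hv : 0 < v) => ?_
  rw [← ENNReal.ofReal_mul (by positivity), ← ENNReal.ofReal_mul (by positivity)]
  congr 1
  rw [mul_rpow ht2.le hv.le, rpow_mul ht.le, rpow_two, rpow_sub_one ht2.ne',
    show t ^ 2 / (4 * (t ^ 2 * v)) = 1 / (4 * v) by field_simp,
    show τ * (t ^ 2 * v) = τ * t ^ 2 * v by ring]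
  field_simp

/-- The second derivative in `τ` of the Fourier side of the extension, as a function of
`τ = ρ²` and `t`. -/
def extProfile (γ τ t : ℝ) : ℝ≥0∞ :=
  besselLaplace (γ + 2) τ * besselLaplace (-γ) (τ * t ^ 2) +
    ENNReal.ofReal (2 * t ^ 2) * (besselLaplace (γ + 1) τ * besselLaplace (1 - γ) (τ * t ^ 2)) +
    ENNReal.ofReal (t ^ 4) * (besselLaplace γ τ * besselLaplace (2 - γ) (τ * t ^ 2))

lemma lintegral_besselLaplace_mul_scaled (a b τ : ℝ) {t : ℝ} (ht : 0 < t) :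
    ∫⁻ u in Ioi (0 : ℝ), ∫⁻ v in Ioi (0 : ℝ),
      ENNReal.ofReal (u ^ (a - 1) * rexp (-(1 / (4 * u))) * rexp (-(τ * u))) *
        ENNReal.ofReal (v ^ (b - 1) * rexp (-(t ^ 2 / (4 * v))) * rexp (-(τ * v))) =
      ENNReal.ofReal (t ^ (2 * b)) * (besselLaplace a τ * besselLaplace b (τ * t ^ 2)) := by
  rw [lintegral_lintegral_mul (by fun_prop) (by fun_prop), lintegral_scaled_besselLaplace b τ ht,
    mul_left_comm]
  rfl

lemma lintegral_lintegral_add_add {α β : Type*} [MeasurableSpace α] [MeasurableSpace β]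
    {μ : Measure α} {ν : Measure β} [SFinite ν] {f g h : α → β → ℝ≥0∞}
    (hf : Measurable (Function.uncurry f)) (hg : Measurable (Function.uncurry g)) :
    ∫⁻ x, ∫⁻ y, (f x y + g x y + h x y) ∂ν ∂μ =
      ∫⁻ x, ∫⁻ y, f x y ∂ν ∂μ + ∫⁻ x, ∫⁻ y, g x y ∂ν ∂μ + ∫⁻ x, ∫⁻ y, h x y ∂ν ∂μ := by
  have hf1 : ∀ x, Measurable (f x) := fun x => hf.comp measurable_prodMk_left
  have hg1 : ∀ x, Measurable (g x) := fun x => hg.comp measurable_prodMk_left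
  have hf2 : Measurable fun x => ∫⁻ y, f x y ∂ν := hf.lintegral_prod_right'
  have hg2 : Measurable fun x => ∫⁻ y, g x y ∂ν := hg.lintegral_prod_right'
  have hfg2 : Measurable fun x => ∫⁻ y, f x y ∂ν + ∫⁻ y, g x y ∂ν := hf2.add hg2
  rw [← lintegral_add_left hf2, ← lintegral_add_left hfg2]
  refine lintegral_congr fun x => ?_
  have hfg1 : Measurable fun y => f x y + g x y := (hf1 x).add (hg1 x)
  rw [lintegral_add_left hfg1, lintegral_add_left (hf1 x)]

lemma mixDensity_mul_sq_mul_exp (γ τ t : ℝ) {u v : ℝ} (hu : 0 < u) (hv : 0 < v) :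
    ENNReal.ofReal (mixDensity γ t (u, v)) *
        ENNReal.ofReal ((u + v) ^ 2 * rexp (-(τ * (u + v)))) =
      ENNReal.ofReal (u ^ (γ + 2 - 1) * rexp (-(1 / (4 * u))) * rexp (-(τ * u))) *
          ENNReal.ofReal (v ^ (-γ - 1) * rexp (-(t ^ 2 / (4 * v))) * rexp (-(τ * v))) +
        2 * (ENNReal.ofReal (u ^ (γ + 1 - 1) * rexp (-(1 / (4 * u))) * rexp (-(τ * u))) *
          ENNReal.ofReal (v ^ (1 - γ - 1) * rexp (-(t ^ 2 / (4 * v))) * rexp (-(τ * v)))) +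
        ENNReal.ofReal (u ^ (γ - 1) * rexp (-(1 / (4 * u))) * rexp (-(τ * u))) *
          ENNReal.ofReal (v ^ (2 - γ - 1) * rexp (-(t ^ 2 / (4 * v))) * rexp (-(τ * v))) := by
  rw [show (2 : ℝ≥0∞) = ENNReal.ofReal 2 by simp, mixDensity]
  rw [← ENNReal.ofReal_mul (by positivity), ← ENNReal.ofReal_mul (by positivity),
    ← ENNReal.ofReal_mul (by positivity), ← ENNReal.ofReal_mul (by positivity),
    ← ENNReal.ofReal_mul (by positivity), ← ENNReal.ofReal_add (by positivity) (by positivity),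
    ← ENNReal.ofReal_add (by positivity) (by positivity)]
  congr 1
  rw [show γ + 2 - 1 = (γ - 1) + 2 by ring, show γ + 1 - 1 = (γ - 1) + 1 by ring,
    show 1 - γ - 1 = (-γ - 1) + 1 by ring, show 2 - γ - 1 = (-γ - 1) + 2 by ring,
    rpow_add hu, rpow_add hu, rpow_add hv, rpow_add hv, rpow_two, rpow_two, rpow_one, rpow_one,
    show -(τ * (u + v)) = -(τ * u) + -(τ * v) by ring, exp_add]
  ring

lemma lintegral_mixMeasure_sq_mul_exp (γ τ : ℝ) {t : ℝ} (ht : 0 < t) :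
    ENNReal.ofReal (t ^ (2 * γ)) *
        ∫⁻ ω, ENNReal.ofReal ((ω.1 + ω.2) ^ 2 * rexp (-(τ * (ω.1 + ω.2)))) ∂(mixMeasure γ t) =
      extProfile γ τ t := by
  have hsum : ∫⁻ ω, ENNReal.ofReal ((ω.1 + ω.2) ^ 2 * rexp (-(τ * (ω.1 + ω.2)))) ∂(mixMeasure γ t) =
      ENNReal.ofReal (t ^ (2 * (-γ))) * (besselLaplace (γ + 2) τ * besselLaplace (-γ) (τ * t ^ 2)) +
      2 * (ENNReal.ofReal (t ^ (2 * (1 - γ))) *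
        (besselLaplace (γ + 1) τ * besselLaplace (1 - γ) (τ * t ^ 2))) +
      ENNReal.ofReal (t ^ (2 * (2 - γ))) *
        (besselLaplace γ τ * besselLaplace (2 - γ) (τ * t ^ 2)) := by
    rw [lintegral_mixMeasure _ _ (by fun_prop)]
    rw [setLIntegral_congr_fun measurableSet_Ioi fun u hu => setLIntegral_congr_fun
      measurableSet_Ioi fun v hv => mixDensity_mul_sq_mul_exp γ τ t hu hv]
    rw [lintegral_lintegral_add_add (by unfold Function.uncurry; fun_prop)
      (by unfold Function.uncurry; fun_prop)]
    simp only [lintegral_const_mul' _ _ ENNReal.ofNat_ne_top]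
    rw [lintegral_besselLaplace_mul_scaled _ _ _ ht, lintegral_besselLaplace_mul_scaled _ _ _ ht,
      lintegral_besselLaplace_mul_scaled _ _ _ ht]
  have e0 : ENNReal.ofReal (t ^ (2 * γ)) * ENNReal.ofReal (t ^ (2 * (-γ))) = 1 := by
    rw [← ENNReal.ofReal_mul (by positivity), ← rpow_add ht,
      show 2 * γ + 2 * (-γ) = 0 by ring, rpow_zero, ENNReal.ofReal_one]
  have e1 : ENNReal.ofReal (t ^ (2 * γ)) * (2 * ENNReal.ofReal (t ^ (2 * (1 - γ)))) =
      ENNReal.ofReal (2 * t ^ 2) := by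
    rw [show (2 : ℝ≥0∞) = ENNReal.ofReal 2 by simp, ← ENNReal.ofReal_mul (by positivity),
      ← ENNReal.ofReal_mul (by positivity), mul_left_comm, ← rpow_add ht,
      show 2 * γ + 2 * (1 - γ) = 2 by ring, rpow_two]
  have e2 : ENNReal.ofReal (t ^ (2 * γ)) * ENNReal.ofReal (t ^ (2 * (2 - γ))) =
      ENNReal.ofReal (t ^ 4) := by
    rw [← ENNReal.ofReal_mul (by positivity), ← rpow_add ht,
      show 2 * γ + 2 * (2 - γ) = (4 : ℕ) by push_cast; ring, rpow_natCast]
  rw [hsum, extProfile, ← e1, ← e2, mul_add, mul_add, ← mul_assoc, e0, one_mul]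
  ring

/-- The weighted energy of the extension at height `t`, on the Fourier side. -/
lemma lintegral_norm_pow_four_mul_sq_ext {n : ℕ} {γ : ℝ} (hγ : 0 < γ) (hn : 2 * γ < n) {t : ℝ}
    (ht : 0 < t) :
    ∫⁻ x : EuclideanSpace ℝ (Fin n), ENNReal.ofReal (‖x‖ ^ 4) *
        (∫⁻ ξ, ENNReal.ofReal (extIntegrand n γ x t ξ)) ^ 2 =
      ENNReal.ofReal (extConst n γ ^ 2 * ((4 * π) ^ ((n : ℝ) / 2) * (4 * n * (n + 2)) /
          Real.Gamma ((n : ℝ) / 2 + 2))) *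
        ∫⁻ τ in Ioi (0 : ℝ), ENNReal.ofReal (τ ^ ((n : ℝ) / 2 + 1)) * extProfile γ τ t ^ 2 := by
  have hn0 : 0 < n := by
    have : (0 : ℝ) < n := by linarith
    exact_mod_cast this
  have hG := Real.Gamma_pos_of_pos (s := (n : ℝ) / 2 + 2) (by positivity)
  have hc := extConst_pos hγ hn
  have h := lintegral_norm_pow_four_mul_sq_gaussian_mixture hn0 (ν := mixMeasure γ t)
    (P := fun ω => ω.1 + ω.2) (by fun_prop) (ae_mixMeasure_pos γ t)
  calc
    _ = ∫⁻ x : EuclideanSpace ℝ (Fin n), ENNReal.ofReal (extConst n γ * t ^ (2 * γ)) ^ 2 *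
          (ENNReal.ofReal (‖x‖ ^ 4) * (∫⁻ ω, ENNReal.ofReal ((ω.1 + ω.2) ^ (-((n : ℝ) / 2)) *
          rexp (-(‖x‖ ^ 2 / (4 * (ω.1 + ω.2))))) ∂(mixMeasure γ t)) ^ 2) := by
        refine lintegral_congr fun x => ?_
        rw [lintegral_extIntegrand hγ hn x ht]
        ring
    _ = ENNReal.ofReal (extConst n γ ^ 2) * ENNReal.ofReal ((4 * π) ^ ((n : ℝ) / 2) *
          (4 * n * (n + 2)) / Real.Gamma ((n : ℝ) / 2 + 2)) *
          (ENNReal.ofReal (t ^ (2 * γ)) ^ 2 * ∫⁻ τ in Ioi (0 : ℝ),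
            ENNReal.ofReal (τ ^ ((n : ℝ) / 2 + 1)) *
          (∫⁻ ω, ENNReal.ofReal ((ω.1 + ω.2) ^ 2 * rexp (-(τ * (ω.1 + ω.2))))
            ∂(mixMeasure γ t)) ^ 2) := by
        rw [lintegral_const_mul' _ _ (ENNReal.pow_ne_top ENNReal.ofReal_ne_top), h,
          ENNReal.ofReal_mul hc.le, ENNReal.ofReal_pow hc.le]
        ring
    _ = _ := by
        rw [← ENNReal.ofReal_mul (by positivity),
          ← lintegral_const_mul' _ _ (ENNReal.pow_ne_top ENNReal.ofReal_ne_top)]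
        congr 1
        refine lintegral_congr fun τ => ?_
        rw [← lintegral_mixMeasure_sq_mul_exp γ τ ht]
        ring

/-! ### Reduction to one-dimensional moments -/

lemma lintegral_rpow_mul_comp_mul_sq (G : ℝ → ℝ≥0∞) (p : ℝ) {τ : ℝ} (hτ : 0 < τ) :
    ∫⁻ t in Ioi (0 : ℝ), ENNReal.ofReal (t ^ (2 * p - 1)) * G (τ * t ^ 2) =
      ENNReal.ofReal (1 / 2 * τ ^ (-p)) *
        ∫⁻ z in Ioi (0 : ℝ), ENNReal.ofReal (z ^ (p - 1)) * G z := by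
  rw [lintegral_Ioi_comp_mul (fun z => ENNReal.ofReal (z ^ (p - 1)) * G z) hτ,
    lintegral_Ioi_comp_rpow (fun y => ENNReal.ofReal τ *
      (ENNReal.ofReal ((τ * y) ^ (p - 1)) * G (τ * y))) (two_ne_zero (α := ℝ)),
    ← lintegral_const_mul' _ _ ENNReal.ofReal_ne_top]
  refine setLIntegral_congr_fun measurableSet_Ioi fun t (ht : 0 < t) => ?_
  simp only [rpow_two, ← mul_assoc]
  congr 1
  rw [← ENNReal.ofReal_mul (by positivity), ← ENNReal.ofReal_mul (by positivity),
    ← ENNReal.ofReal_mul (by positivity)]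
  congr 1
  rw [mul_rpow hτ.le (by positivity), ← rpow_two, ← rpow_mul ht.le, rpow_neg hτ.le,
    rpow_sub_one hτ.ne', show 2 * p - 1 = (2 - 1) + 2 * (p - 1) by ring, rpow_add ht,
    abs_of_pos two_pos]
  field_simp

lemma lintegral_profile_term {a b c d p q e : ℝ} (he : q + p - 1 = e) (hp : 0 < p)
    (hcd : 0 < p - c - d) (hc : 0 < p - c) (hd : 0 < p - d) (hq : 0 < q) (hab : 0 < q - a - b)
    (ha : 0 < q - a) (hb : 0 < q - b) :
    ∫⁻ t in Ioi (0 : ℝ), ∫⁻ τ in Ioi (0 : ℝ), ENNReal.ofReal (t ^ (2 * p - 1)) *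
        (ENNReal.ofReal (τ ^ e) * (besselLaplace a τ * besselLaplace b τ *
          (besselLaplace c (τ * t ^ 2) * besselLaplace d (τ * t ^ 2)))) =
      ENNReal.ofReal (1 / 2 * (besselMoment a b q * besselMoment c d p)) := by
  have hma := measurable_besselLaplace a
  have hmb := measurable_besselLaplace b
  have hmc := measurable_besselLaplace c
  have hmd := measurable_besselLaplace d
  have hM := besselMoment_pos hp hcd hc hd
  rw [lintegral_lintegral_swap (by fun_prop)]
  calc
    _ = ∫⁻ τ in Ioi (0 : ℝ), ENNReal.ofReal (1 / 2 * besselMoment c d p) *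
          (ENNReal.ofReal (τ ^ (q - 1)) * (besselLaplace a τ * besselLaplace b τ)) := by
        refine setLIntegral_congr_fun measurableSet_Ioi fun τ (hτ : 0 < τ) => ?_
        have h := lintegral_rpow_mul_comp_mul_sq
          (fun z => besselLaplace c z * besselLaplace d z) p hτ
        simp only [lintegral_rpow_mul_besselLaplace_mul hp hcd hc hd] at h
        have h2 : ∀ t : ℝ, ENNReal.ofReal (t ^ (2 * p - 1)) *
            (ENNReal.ofReal (τ ^ e) * (besselLaplace a τ * besselLaplace b τ *
              (besselLaplace c (τ * t ^ 2) * besselLaplace d (τ * t ^ 2)))) =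
            ENNReal.ofReal (τ ^ e) * (besselLaplace a τ * besselLaplace b τ) *
              (ENNReal.ofReal (t ^ (2 * p - 1)) *
              (besselLaplace c (τ * t ^ 2) * besselLaplace d (τ * t ^ 2))) := fun t => by ring
        simp only [h2]
        rw [lintegral_const_mul _ (by fun_prop), h, ← ENNReal.ofReal_mul (by positivity),
          mul_right_comm, ← ENNReal.ofReal_mul (by positivity), ← mul_assoc (ENNReal.ofReal _)
            (ENNReal.ofReal (τ ^ (q - 1))), ← ENNReal.ofReal_mul (by positivity)]
        congr 2
        rw [show q - 1 = e + -p by rw [← he]; ring, rpow_add hτ]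
        ring
    _ = _ := by
        rw [lintegral_const_mul _ (by fun_prop),
          lintegral_rpow_mul_besselLaplace_mul hq hab ha hb, ← ENNReal.ofReal_mul (by positivity)]
        congr 1
        ring

/-- The sum of products of moments giving the weighted energy. -/
def energySum (n : ℕ) (γ : ℝ) : ℝ :=
  1 / 2 * (besselMoment (γ + 2) (γ + 2) (n / 2 + 1 + γ) * besselMoment (-γ) (-γ) (1 - γ)) +
  4 * (1 / 2 * (besselMoment (γ + 2) (γ + 1) (n / 2 + γ) * besselMoment (-γ) (1 - γ) (2 - γ))) +
  4 * (1 / 2 * (besselMoment (γ + 1) (γ + 1) (n / 2 - 1 + γ) *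
    besselMoment (1 - γ) (1 - γ) (3 - γ))) +
  2 * (1 / 2 * (besselMoment (γ + 2) γ (n / 2 - 1 + γ) * besselMoment (-γ) (2 - γ) (3 - γ))) +
  4 * (1 / 2 * (besselMoment (γ + 1) γ (n / 2 - 2 + γ) * besselMoment (1 - γ) (2 - γ) (4 - γ))) +
  1 / 2 * (besselMoment γ γ (n / 2 - 3 + γ) * besselMoment (2 - γ) (2 - γ) (5 - γ))

lemma lintegral_lintegral_const_mul {α β : Type*} [MeasurableSpace α] [MeasurableSpace β]
    {μ : Measure α} {ν : Measure β} {c : ℝ≥0∞} (hc : c ≠ ⊤) (f : α → β → ℝ≥0∞) :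
    ∫⁻ x, ∫⁻ y, c * f x y ∂ν ∂μ = c * ∫⁻ x, ∫⁻ y, f x y ∂ν ∂μ := by
  simp only [lintegral_const_mul' _ _ hc]

lemma lintegral_rpow_mul_extProfile_sq {n : ℕ} {γ : ℝ} (hγ0 : 0 < γ) (hγ1 : γ < 1)
    (hn : 2 * γ + 8 < n) :
    ∫⁻ t in Ioi (0 : ℝ), ENNReal.ofReal (t ^ (1 - 2 * γ)) * ∫⁻ τ in Ioi (0 : ℝ),
        ENNReal.ofReal (τ ^ ((n : ℝ) / 2 + 1)) * extProfile γ τ t ^ 2 =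
      ENNReal.ofReal (energySum n γ) := by
  have hm0 := measurable_besselLaplace (γ + 2)
  have hm1 := measurable_besselLaplace (γ + 1)
  have hm2 := measurable_besselLaplace γ
  have hm3 := measurable_besselLaplace (-γ)
  have hm4 := measurable_besselLaplace (1 - γ)
  have hm5 := measurable_besselLaplace (2 - γ)
  let T : ℝ → ℝ → ℝ → ℝ → ℝ → ℝ → ℝ → ℝ≥0∞ := fun a b c d p t τ =>
    ENNReal.ofReal (t ^ (2 * p - 1)) * (ENNReal.ofReal (τ ^ ((n : ℝ) / 2 + 1)) *
      (besselLaplace a τ * besselLaplace b τ *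
        (besselLaplace c (τ * t ^ 2) * besselLaplace d (τ * t ^ 2))))
  have hT : ∀ a b c d p, Measurable (Function.uncurry (T a b c d p)) := by
    intro a b c d p
    have := measurable_besselLaplace a
    have := measurable_besselLaplace b
    have := measurable_besselLaplace c
    have := measurable_besselLaplace d
    unfold Function.uncurry
    fun_prop
  have hT4 : ∀ a b c d p, Measurable (Function.uncurry fun t τ => 4 * T a b c d p t τ) :=
    fun a b c d p => (hT a b c d p).const_mul 4
  have hpt : ∀ t ∈ Ioi (0 : ℝ), ∀ τ ∈ Ioi (0 : ℝ), ENNReal.ofReal (t ^ (1 - 2 * γ)) *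
      (ENNReal.ofReal (τ ^ ((n : ℝ) / 2 + 1)) * extProfile γ τ t ^ 2) =
      T (γ + 2) (γ + 2) (-γ) (-γ) (1 - γ) t τ + 4 * T (γ + 2) (γ + 1) (-γ) (1 - γ) (2 - γ) t τ +
        (4 * T (γ + 1) (γ + 1) (1 - γ) (1 - γ) (3 - γ) t τ +
          T (γ + 2) γ (-γ) (2 - γ) (3 - γ) t τ +
          (T (γ + 2) γ (-γ) (2 - γ) (3 - γ) t τ + 4 * T (γ + 1) γ (1 - γ) (2 - γ) (4 - γ) t τ +
            T γ γ (2 - γ) (2 - γ) (5 - γ) t τ)) := by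
    intro t (ht : 0 < t) τ (hτ : 0 < τ)
    have hk : ∀ (k : ℕ) (r : ℝ), r = 2 * k + (1 - 2 * γ) → ENNReal.ofReal (t ^ r) =
        ENNReal.ofReal (t ^ 2) ^ k * ENNReal.ofReal (t ^ (1 - 2 * γ)) := by
      rintro k _ rfl
      rw [← ENNReal.ofReal_pow (by positivity), ← ENNReal.ofReal_mul (by positivity), rpow_add ht,
        rpow_mul ht.le, rpow_two, rpow_natCast]
    simp only [T, extProfile]
    rw [hk 0 (2 * (1 - γ) - 1) (by push_cast; ring), hk 1 (2 * (2 - γ) - 1) (by push_cast; ring),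
      hk 2 (2 * (3 - γ) - 1) (by push_cast; ring), hk 3 (2 * (4 - γ) - 1) (by push_cast; ring),
      hk 4 (2 * (5 - γ) - 1) (by push_cast; ring), ENNReal.ofReal_mul two_pos.le,
      show t ^ 4 = (t ^ 2) ^ 2 by ring, ENNReal.ofReal_pow (by positivity : 0 ≤ t ^ 2),
      ENNReal.ofReal_ofNat]
    ring
  calc
    _ = ∫⁻ t in Ioi (0 : ℝ), ∫⁻ τ in Ioi (0 : ℝ), ENNReal.ofReal (t ^ (1 - 2 * γ)) *
        (ENNReal.ofReal (τ ^ ((n : ℝ) / 2 + 1)) * extProfile γ τ t ^ 2) := by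
        simp only [lintegral_const_mul' _ _ ENNReal.ofReal_ne_top]
    _ = _ := by
        rw [setLIntegral_congr_fun measurableSet_Ioi fun t ht => setLIntegral_congr_fun
          measurableSet_Ioi fun τ hτ => hpt t ht τ hτ]
        rw [lintegral_lintegral_add_add (hT _ _ _ _ _) (hT4 _ _ _ _ _),
          lintegral_lintegral_add_add (hT4 _ _ _ _ _) (hT _ _ _ _ _),
          lintegral_lintegral_add_add (hT _ _ _ _ _) (hT4 _ _ _ _ _)]
        simp only [lintegral_lintegral_const_mul ENNReal.ofNat_ne_top]
        have m1 : 0 < besselMoment (γ + 2) (γ + 2) (n / 2 + 1 + γ) :=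
          besselMoment_pos (by linarith) (by linarith) (by linarith) (by linarith)
        have m2 : 0 < besselMoment (γ + 2) (γ + 1) (n / 2 + γ) :=
          besselMoment_pos (by linarith) (by linarith) (by linarith) (by linarith)
        have m3 : 0 < besselMoment (γ + 1) (γ + 1) (n / 2 - 1 + γ) :=
          besselMoment_pos (by linarith) (by linarith) (by linarith) (by linarith)
        have m4 : 0 < besselMoment (γ + 2) γ (n / 2 - 1 + γ) :=
          besselMoment_pos (by linarith) (by linarith) (by linarith) (by linarith)
        have m5 : 0 < besselMoment (γ + 1) γ (n / 2 - 2 + γ) :=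
          besselMoment_pos (by linarith) (by linarith) (by linarith) (by linarith)
        have m6 : 0 < besselMoment γ γ (n / 2 - 3 + γ) :=
          besselMoment_pos (by linarith) (by linarith) (by linarith) (by linarith)
        have k1 : 0 < besselMoment (-γ) (-γ) (1 - γ) :=
          besselMoment_pos (by linarith) (by linarith) (by linarith) (by linarith)
        have k2 : 0 < besselMoment (-γ) (1 - γ) (2 - γ) :=
          besselMoment_pos (by linarith) (by linarith) (by linarith) (by linarith)
        have k3 : 0 < besselMoment (1 - γ) (1 - γ) (3 - γ) :=
          besselMoment_pos (by linarith) (by linarith) (by linarith) (by linarith)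
        have k4 : 0 < besselMoment (-γ) (2 - γ) (3 - γ) :=
          besselMoment_pos (by linarith) (by linarith) (by linarith) (by linarith)
        have k5 : 0 < besselMoment (1 - γ) (2 - γ) (4 - γ) :=
          besselMoment_pos (by linarith) (by linarith) (by linarith) (by linarith)
        have k6 : 0 < besselMoment (2 - γ) (2 - γ) (5 - γ) :=
          besselMoment_pos (by linarith) (by linarith) (by linarith) (by linarith)
        simp only [T]
        rw [lintegral_profile_term (q := n / 2 + 1 + γ), lintegral_profile_term (q := n / 2 + γ),
          lintegral_profile_term (q := n / 2 - 1 + γ), lintegral_profile_term (q := n / 2 - 1 + γ),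
          lintegral_profile_term (q := n / 2 - 2 + γ), lintegral_profile_term (q := n / 2 - 3 + γ)]
        any_goals linarith
        rw [show (4 : ℝ≥0∞) = ENNReal.ofReal 4 by simp]
        repeat rw [← ENNReal.ofReal_mul (by positivity)]
        repeat rw [← ENNReal.ofReal_add (by positivity) (by positivity)]
        rw [energySum]
        congr 1
        ring

/-! ### From lower integrals to Bochner integrals -/

lemma integral_integral_toReal {α β : Type*} [MeasurableSpace α] [MeasurableSpace β]
    {μ : Measure α} {ν : Measure β} [SFinite ν] {F : α → β → ℝ≥0∞}
    (hF : Measurable (Function.uncurry F)) (hfin : ∫⁻ x, ∫⁻ y, F x y ∂ν ∂μ ≠ ⊤) :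
    ∫ x, ∫ y, (F x y).toReal ∂ν ∂μ = (∫⁻ x, ∫⁻ y, F x y ∂ν ∂μ).toReal := by
  have hF1 : ∀ x, Measurable (F x) := fun x => hF.comp measurable_prodMk_left
  have hF2 : Measurable fun x => ∫⁻ y, F x y ∂ν := hF.lintegral_prod_right'
  have hae := ae_lt_top hF2 hfin
  rw [← integral_toReal hF2.aemeasurable hae]
  refine integral_congr_ae ?_
  filter_upwards [hae] with x hx
  exact integral_toReal (hF1 x).aemeasurable (ae_lt_top (hF1 x) hx.ne)

lemma png_pos {n : ℕ} {γ : ℝ} (hγ : 0 < γ) : 0 < png n γ := by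
  have h1 := Real.Gamma_pos_of_pos (s := ((n : ℝ) + 2 * γ) / 2) (by positivity)
  have h2 := Real.Gamma_pos_of_pos hγ
  unfold png
  positivity

lemma measurable_extIntegrand (n : ℕ) (γ : ℝ) :
    Measurable fun p : (ℝ × EuclideanSpace ℝ (Fin n)) × EuclideanSpace ℝ (Fin n) =>
      extIntegrand n γ p.1.2 p.1.1 p.2 := by
  unfold extIntegrand bubble
  fun_prop

lemma bubbleExt_eq_toReal_lintegral {n : ℕ} {γ : ℝ} (hγ : 0 < γ) (hn : 2 * γ < n)
    (x : EuclideanSpace ℝ (Fin n)) {t : ℝ} (ht : 0 < t) :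
    bubbleExt n γ 1 0 x t =
      png n γ * (∫⁻ ξ, ENNReal.ofReal (extIntegrand n γ x t ξ)).toReal := by
  have hm : Measurable (extIntegrand n γ x t) :=
    (measurable_extIntegrand n γ).comp (measurable_prodMk_left (x := (t, x)))
  rw [← integral_eq_lintegral_of_nonneg_ae
    (Eventually.of_forall fun ξ => extIntegrand_nonneg hγ hn x ht ξ) hm.aestronglyMeasurable]
  rfl

lemma energySum_nonneg {n : ℕ} {γ : ℝ} (hγ0 : 0 < γ) (hγ1 : γ < 1) (hn : 2 * γ + 8 < n) :
    0 ≤ energySum n γ := by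
  unfold energySum
  repeat' first
    | refine (besselMoment_pos ?_ ?_ ?_ ?_).le
    | apply add_nonneg
    | apply mul_nonneg
  all_goals linarith

lemma integral_weighted_bubbleExt_sq {n : ℕ} {γ : ℝ} (hγ0 : 0 < γ) (hγ1 : γ < 1)
    (hn : 2 * γ + 8 < n) :
    (∫ t in Ioi (0 : ℝ), ∫ x : EuclideanSpace ℝ (Fin n),
        t ^ (1 - 2 * γ) * ‖x‖ ^ 4 * (bubbleExt n γ 1 0 x t) ^ 2) =
      png n γ ^ 2 * (extConst n γ ^ 2 * ((4 * π) ^ ((n : ℝ) / 2) * (4 * n * (n + 2)) /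
          Real.Gamma ((n : ℝ) / 2 + 2))) * energySum n γ := by
  have hn2 : 2 * γ < n := by linarith
  have hp := png_pos (n := n) hγ0
  have hc := extConst_pos hγ0 hn2
  have hG := Real.Gamma_pos_of_pos (s := (n : ℝ) / 2 + 2) (by positivity)
  let V : ℝ → EuclideanSpace ℝ (Fin n) → ℝ≥0∞ := fun t x =>
    ∫⁻ ξ, ENNReal.ofReal (extIntegrand n γ x t ξ)
  have hV : Measurable (Function.uncurry V) :=
    (measurable_extIntegrand n γ).ennreal_ofReal.lintegral_prod_right'
  let F : ℝ → EuclideanSpace ℝ (Fin n) → ℝ≥0∞ := fun t x =>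
    ENNReal.ofReal (png n γ ^ 2) * (ENNReal.ofReal (t ^ (1 - 2 * γ)) *
      (ENNReal.ofReal (‖x‖ ^ 4) * V t x ^ 2))
  have hF : Measurable (Function.uncurry F) := by
    have h : Measurable fun p : ℝ × EuclideanSpace ℝ (Fin n) => V p.1 p.2 := hV
    unfold Function.uncurry
    fun_prop
  have htot : ∫⁻ t in Ioi (0 : ℝ), ∫⁻ x, F t x = ENNReal.ofReal (png n γ ^ 2 *
      (extConst n γ ^ 2 * ((4 * π) ^ ((n : ℝ) / 2) * (4 * n * (n + 2)) /
          Real.Gamma ((n : ℝ) / 2 + 2))) * energySum n γ) := by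
    rw [ENNReal.ofReal_mul (by positivity), ← lintegral_rpow_mul_extProfile_sq hγ0 hγ1 hn,
      ← lintegral_const_mul' _ _ ENNReal.ofReal_ne_top]
    refine setLIntegral_congr_fun measurableSet_Ioi fun t (ht : 0 < t) => ?_
    simp only [F, V]
    rw [lintegral_const_mul' _ _ ENNReal.ofReal_ne_top,
      lintegral_const_mul' _ _ ENNReal.ofReal_ne_top, lintegral_norm_pow_four_mul_sq_ext hγ0 hn2 ht,
      ENNReal.ofReal_mul (sq_nonneg (png n γ))]
    ring
  have hnn := energySum_nonneg hγ0 hγ1 hn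
  have h := integral_integral_toReal (μ := volume.restrict (Ioi 0)) hF
    (by rw [htot]; exact ENNReal.ofReal_ne_top)
  rw [htot, ENNReal.toReal_ofReal (by positivity)] at h
  rw [← h]
  refine setIntegral_congr_fun measurableSet_Ioi fun t (ht : 0 < t) => ?_
  refine integral_congr_ae (Eventually.of_forall fun x => ?_)
  simp only [F, V]
  rw [bubbleExt_eq_toReal_lintegral hγ0 hn2 x ht, ENNReal.toReal_mul, ENNReal.toReal_mul,
    ENNReal.toReal_mul, ENNReal.toReal_pow, ENNReal.toReal_ofReal (by positivity),
    ENNReal.toReal_ofReal (by positivity), ENNReal.toReal_ofReal (by positivity)]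
  ring

/-! ### The constants `A₁` and `B₂` -/

lemma lintegral_Ioi_comp_exp (g : ℝ → ℝ≥0∞) :
    ∫⁻ u in Ioi (0 : ℝ), g u = ∫⁻ s, ENNReal.ofReal (rexp s) * g (rexp s) := by
  have h := lintegral_image_eq_lintegral_abs_deriv_mul MeasurableSet.univ
    (fun s _ => (Real.hasDerivAt_exp s).hasDerivWithinAt) Real.exp_injective.injOn g
  rw [image_univ, Real.range_exp] at h
  simpa [abs_of_pos (Real.exp_pos _)] using h

lemma lintegral_eq_lintegral_Ioi_add_neg {f : ℝ → ℝ≥0∞} (hf : Measurable f) :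
    ∫⁻ s, f s = ∫⁻ s in Ioi (0 : ℝ), (f s + f (-s)) := by
  have h := (Measure.measurePreserving_neg (volume : Measure ℝ)).setLIntegral_comp_preimage
    (measurableSet_Iio (a := 0)) hf
  rw [neg_preimage, neg_Iio, neg_zero] at h
  rw [lintegral_add_left hf, h, ← lintegral_add_compl f (measurableSet_Ioi (a := 0)), compl_Ioi,
    setLIntegral_congr Iio_ae_eq_Iic]

lemma besselLaplace_sq (a : ℝ) {t : ℝ} (ht : 0 < t) :
    besselLaplace a (t ^ 2) = ENNReal.ofReal (2 * (2 * t) ^ (-a)) *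
      ∫⁻ s in Ioi (0 : ℝ), ENNReal.ofReal (rexp (-t * cosh s) * cosh (a * s)) := by
  rw [besselLaplace, lintegral_Ioi_comp_mul _ (inv_pos.2 (mul_pos two_pos ht)),
    lintegral_Ioi_comp_exp, lintegral_eq_lintegral_Ioi_add_neg (by fun_prop),
    ← lintegral_const_mul' _ _ ENNReal.ofReal_ne_top]
  have key : ∀ s, ENNReal.ofReal (rexp s) * (ENNReal.ofReal (2 * t)⁻¹ *
      ENNReal.ofReal (((2 * t)⁻¹ * rexp s) ^ (a - 1) * rexp (-(1 / (4 * ((2 * t)⁻¹ * rexp s)))) *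
        rexp (-(t ^ 2 * ((2 * t)⁻¹ * rexp s))))) =
      ENNReal.ofReal ((2 * t) ^ (-a) * (rexp (-t * cosh s) * rexp (a * s))) := by
    intro s
    rw [← ENNReal.ofReal_mul (by positivity), ← ENNReal.ofReal_mul (by positivity)]
    congr 1
    rw [mul_assoc _ (rexp _) (rexp _), ← exp_add, rpow_sub_one (by positivity),
      mul_rpow (by positivity) (by positivity), inv_rpow (by positivity), ← rpow_neg (by positivity),
      ← exp_mul, mul_comm s a, show -(1 / (4 * ((2 * t)⁻¹ * rexp s))) +
        -(t ^ 2 * ((2 * t)⁻¹ * rexp s)) = -t * cosh s by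
          rw [cosh_eq, exp_neg]; field_simp; ring]
    field_simp
  refine setLIntegral_congr_fun measurableSet_Ioi fun s _ => ?_
  simp only [key]
  rw [← ENNReal.ofReal_add (by positivity) (by positivity), ← ENNReal.ofReal_mul (by positivity),
    cosh_neg, cosh_eq (a * s), mul_neg]
  congr 1
  ring

lemma besselK_eq_besselLaplace (a : ℝ) {t : ℝ} (ht : 0 < t) :
    besselK a t = 1 / 2 * (2 * t) ^ a * (besselLaplace a (t ^ 2)).toReal := by
  have hK : besselK a t =
      (∫⁻ s in Ioi (0 : ℝ), ENNReal.ofReal (rexp (-t * cosh s) * cosh (a * s))).toReal :=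
    integral_eq_lintegral_of_nonneg_ae
      (Eventually.of_forall fun s => mul_nonneg (exp_pos _).le (cosh_pos _).le)
      (by fun_prop)
  rw [besselLaplace_sq a ht, ENNReal.toReal_mul, ENNReal.toReal_ofReal (by positivity), ← hK,
    rpow_neg (by positivity)]
  field_simp

lemma besselK_neg (a t : ℝ) : besselK (-a) t = besselK a t := by
  simp [besselK]

lemma integral_rpow_mul_besselLaplace_sq {a p : ℝ} (hp : 0 < p) (haa : 0 < p - a - a)
    (ha : 0 < p - a) :
    ∫ t in Ioi (0 : ℝ), t ^ (2 * p - 1) * (besselLaplace a (t ^ 2)).toReal ^ 2 =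
      1 / 2 * besselMoment a a p := by
  have hma := measurable_besselLaplace a
  have hM := besselMoment_pos hp haa ha ha
  have h : ∫⁻ t in Ioi (0 : ℝ), ENNReal.ofReal (t ^ (2 * p - 1)) *
      (besselLaplace a (t ^ 2) * besselLaplace a (t ^ 2)) =
      ENNReal.ofReal (1 / 2 * besselMoment a a p) := by
    have h := lintegral_rpow_mul_comp_mul_sq (fun z => besselLaplace a z * besselLaplace a z) p
      one_pos
    simpa only [lintegral_rpow_mul_besselLaplace_mul hp haa ha ha, one_mul, one_rpow, mul_one,
      ← ENNReal.ofReal_mul (by norm_num : (0 : ℝ) ≤ 1 / 2)] using h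
  have hmeas : Measurable fun t : ℝ => ENNReal.ofReal (t ^ (2 * p - 1)) *
      (besselLaplace a (t ^ 2) * besselLaplace a (t ^ 2)) := by fun_prop
  rw [← ENNReal.toReal_ofReal (by positivity : 0 ≤ 1 / 2 * besselMoment a a p), ← h,
    ← integral_toReal hmeas.aemeasurable (ae_lt_top hmeas (by rw [h]; exact ENNReal.ofReal_ne_top))]
  refine setIntegral_congr_fun measurableSet_Ioi fun t (ht : 0 < t) => ?_
  rw [ENNReal.toReal_mul, ENNReal.toReal_mul, ENNReal.toReal_ofReal (by positivity), sq]

lemma Aone_eq {γ : ℝ} (hγ0 : 0 < γ) (hγ1 : γ < 1) :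
    Aone γ = (4 ^ γ * Real.Gamma γ)⁻¹ ^ 2 * (1 / 2 * besselMoment (-γ) (-γ) (1 - γ)) := by
  have hG := Real.Gamma_pos_of_pos hγ0
  rw [← integral_rpow_mul_besselLaplace_sq (by linarith) (by linarith) (by linarith),
    ← integral_const_mul, Aone]
  refine setIntegral_congr_fun measurableSet_Ioi fun t (ht : 0 < t) => ?_
  simp only [phiK]
  rw [← besselK_neg, besselK_eq_besselLaplace _ ht, mul_rpow two_pos.le ht.le,
    show 2 * (1 - γ) - 1 = 1 - 2 * γ by ring, rpow_neg two_pos.le, rpow_neg ht.le,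
    rpow_sub two_pos, show (4 : ℝ) = 2 * 2 by norm_num, mul_rpow two_pos.le two_pos.le, rpow_one]
  field_simp

lemma Btwo_eq {n : ℕ} {γ : ℝ} (hγ0 : 0 < γ) (hn : 2 * γ + 8 < n) :
    Btwo n γ = dTwo n γ ^ 2 * 4 ^ (γ - 1) * (1 / 2 * besselMoment γ γ (n / 2 - 1 + γ)) := by
  rw [← integral_rpow_mul_besselLaplace_sq (by linarith) (by linarith) (by linarith),
    ← integral_const_mul, Btwo]
  refine setIntegral_congr_fun measurableSet_Ioi fun t (ht : 0 < t) => ?_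
  simp only [whatOne]
  rw [besselK_eq_besselLaplace _ ht, mul_rpow two_pos.le ht.le,
    show 2 * ((n : ℝ) / 2 - 1 + γ) - 1 = (n : ℝ) - 3 + 2 * γ by ring, rpow_neg ht.le,
    rpow_sub_one four_ne_zero, show (4 : ℝ) ^ γ = 2 ^ γ * 2 ^ γ by
      rw [← mul_rpow two_pos.le two_pos.le]; norm_num]
  field_simp
  ring

/-! ### Evaluation of the moments -/

lemma Gamma_add_two {x : ℝ} (hx : 0 < x) : Real.Gamma (x + 2) = (x + 1) * (x * Real.Gamma x) := by
  rw [show x + 2 = x + 1 + 1 by ring, Real.Gamma_add_one (by positivity),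
    Real.Gamma_add_one hx.ne']

lemma Gamma_add_three {x : ℝ} (hx : 0 < x) :
    Real.Gamma (x + 3) = (x + 2) * ((x + 1) * (x * Real.Gamma x)) := by
  rw [show x + 3 = x + 2 + 1 by ring, Real.Gamma_add_one (by positivity), Gamma_add_two hx]

lemma Gamma_add_four {x : ℝ} (hx : 0 < x) :
    Real.Gamma (x + 4) = (x + 3) * ((x + 2) * ((x + 1) * (x * Real.Gamma x))) := by
  rw [show x + 4 = x + 3 + 1 by ring, Real.Gamma_add_one (by positivity), Gamma_add_three hx]

lemma besselMoment_eq {a b p e x y z w : ℝ} (hx : p - a - b = x) (hy : p - a = y) (hz : p - b = z)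
    (hw : 2 * p - a - b = w) (he : p = e) :
    besselMoment a b p = 4 ^ x * (Real.Gamma e * Real.Gamma x * (Real.Gamma y * Real.Gamma z /
      Real.Gamma w)) := by
  subst hx hy hz hw he
  rfl

lemma energySum_eq {n : ℕ} {γ : ℝ} (hγ0 : 0 < γ) (hγ1 : γ < 1) (hn : 2 * γ + 8 < n) :
    energySum n γ = (n : ℝ) * ((n : ℝ) + 2) * (15 * ((n : ℝ) - 3) ^ 2 * ((n : ℝ) - 5) ^ 2 +
          (1 - 4 * γ ^ 2) * (10 * (n : ℝ) ^ 2 - 80 * (n : ℝ) + 177 - 12 * γ ^ 2)) /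
        (15 * ((n : ℝ) - 4) * ((n : ℝ) - 6) * ((n : ℝ) - 2 * γ - 4) *
          ((n : ℝ) + 2 * γ - 4) * ((n : ℝ) - 2 * γ - 6) * ((n : ℝ) + 2 * γ - 6)) / 32 *
      (besselMoment (-γ) (-γ) (1 - γ) * besselMoment γ γ (n / 2 - 1 + γ)) := by
  obtain ⟨a, ha⟩ : ∃ a : ℝ, (n : ℝ) = 2 * a + 6 := ⟨((n : ℝ) - 6) / 2, by ring⟩
  have ha0 : 0 < a := by linarith
  have hd : 0 < a - γ := by linarith
  have hs : 0 < a + γ := by linarith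
  have h1 : 0 < 1 - γ := by linarith
  have Gm := Real.Gamma_pos_of_pos hd
  have Gp := Real.Gamma_pos_of_pos hs
  have Ga := Real.Gamma_pos_of_pos ha0
  have G2 := Real.Gamma_pos_of_pos (mul_pos two_pos ha0)
  have K1 : besselMoment (-γ) (-γ) (1 - γ) = 4 ^ (1 + γ) * (Real.Gamma (1 - γ) *
      Real.Gamma (1 + γ)) := by
    rw [besselMoment_eq (x := 1 + γ) (y := 1) (z := 1) (w := 2) (e := 1 - γ)
      (by ring) (by ring) (by ring) (by ring) (by ring)]
    simp
  have K2 : besselMoment (-γ) (1 - γ) (2 - γ) = 4 ^ (1 + γ) * (Real.Gamma (1 - γ) *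
      Real.Gamma (1 + γ)) * ((1 - γ) / 2) := by
    rw [besselMoment_eq (x := 1 + γ) (y := 1 + 1) (z := 1) (w := 1 + 2) (e := 1 - γ + 1)
      (by ring) (by ring) (by ring) (by ring) (by ring)]
    rw [Gamma_add_two one_pos, Real.Gamma_add_one h1.ne', Real.Gamma_add_one one_ne_zero,
      Real.Gamma_one]
    ring
  have K3 : besselMoment (1 - γ) (1 - γ) (3 - γ) = 4 ^ (1 + γ) * (Real.Gamma (1 - γ) *
      Real.Gamma (1 + γ)) * ((1 - γ) * (2 - γ) / 6) := by
    rw [besselMoment_eq (x := 1 + γ) (y := 1 + 1) (z := 1 + 1) (w := 1 + 3) (e := 1 - γ + 2)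
      (by ring) (by ring) (by ring) (by ring) (by ring)]
    rw [Gamma_add_three one_pos, Gamma_add_two h1, Real.Gamma_add_one one_ne_zero, Real.Gamma_one]
    ring
  have K4 : besselMoment (-γ) (2 - γ) (3 - γ) = 4 ^ (1 + γ) * (Real.Gamma (1 - γ) *
      Real.Gamma (1 + γ)) * ((1 - γ) * (2 - γ) / 3) := by
    rw [besselMoment_eq (x := 1 + γ) (y := 1 + 2) (z := 1) (w := 1 + 3) (e := 1 - γ + 2)
      (by ring) (by ring) (by ring) (by ring) (by ring)]
    rw [Gamma_add_three one_pos, Gamma_add_two h1, Gamma_add_two one_pos, Real.Gamma_one]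
    ring
  have K5 : besselMoment (1 - γ) (2 - γ) (4 - γ) = 4 ^ (1 + γ) * (Real.Gamma (1 - γ) *
      Real.Gamma (1 + γ)) * ((1 - γ) * (2 - γ) * (3 - γ) / 12) := by
    rw [besselMoment_eq (x := 1 + γ) (y := 1 + 2) (z := 1 + 1) (w := 1 + 4) (e := 1 - γ + 3)
      (by ring) (by ring) (by ring) (by ring) (by ring)]
    rw [Gamma_add_four one_pos, Gamma_add_three h1, Gamma_add_two one_pos,
      Real.Gamma_add_one one_ne_zero, Real.Gamma_one]
    ring
  have K6 : besselMoment (2 - γ) (2 - γ) (5 - γ) = 4 ^ (1 + γ) * (Real.Gamma (1 - γ) *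
      Real.Gamma (1 + γ)) * ((1 - γ) * (2 - γ) * (3 - γ) * (4 - γ) / 30) := by
    rw [besselMoment_eq (x := 1 + γ) (y := 1 + 2) (z := 1 + 2) (w := 2 + 4) (e := 1 - γ + 4)
      (by ring) (by ring) (by ring) (by ring) (by ring)]
    rw [Gamma_add_four two_pos, Gamma_add_four h1, Gamma_add_two one_pos, Real.Gamma_two,
      Real.Gamma_one]
    ring
  rw [energySum, K1, K2, K3, K4, K5, K6, ha]
  have M0 : besselMoment γ γ ((2 * a + 6) / 2 - 1 + γ) = 4 ^ (a - γ) * 16 * (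
      Real.Gamma (a + γ + 2) * Real.Gamma (a - γ + 2) * (Real.Gamma (a + 2) * Real.Gamma (a + 2) /
      Real.Gamma (2 * a + 4))) := by
    rw [besselMoment_eq (x := a - γ + 2) (y := a + 2) (z := a + 2) (w := 2 * a + 4)
      (e := a + γ + 2)
      (by ring) (by ring) (by ring) (by ring) (by ring), rpow_add four_pos]
    norm_num
  have M1 : besselMoment (γ + 2) (γ + 2) ((2 * a + 6) / 2 + 1 + γ) = 4 ^ (a - γ) * (
      Real.Gamma (a + γ + 4) * Real.Gamma (a - γ) * (Real.Gamma (a + 2) * Real.Gamma (a + 2) /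
      Real.Gamma (2 * a + 4))) :=
    besselMoment_eq (by ring) (by ring) (by ring) (by ring) (by ring)
  have M2 : besselMoment (γ + 2) (γ + 1) ((2 * a + 6) / 2 + γ) = 4 ^ (a - γ) * (
      Real.Gamma (a + γ + 3) * Real.Gamma (a - γ) * (Real.Gamma (a + 1) * Real.Gamma (a + 2) /
      Real.Gamma (2 * a + 3))) :=
    besselMoment_eq (by ring) (by ring) (by ring) (by ring) (by ring)
  have M3 : besselMoment (γ + 1) (γ + 1) ((2 * a + 6) / 2 - 1 + γ) = 4 ^ (a - γ) * (
      Real.Gamma (a + γ + 2) * Real.Gamma (a - γ) * (Real.Gamma (a + 1) * Real.Gamma (a + 1) /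
      Real.Gamma (2 * a + 2))) :=
    besselMoment_eq (by ring) (by ring) (by ring) (by ring) (by ring)
  have M4 : besselMoment (γ + 2) γ ((2 * a + 6) / 2 - 1 + γ) = 4 ^ (a - γ) * (
      Real.Gamma (a + γ + 2) * Real.Gamma (a - γ) * (Real.Gamma a * Real.Gamma (a + 2) /
      Real.Gamma (2 * a + 2))) :=
    besselMoment_eq (by ring) (by ring) (by ring) (by ring) (by ring)
  have M5 : besselMoment (γ + 1) γ ((2 * a + 6) / 2 - 2 + γ) = 4 ^ (a - γ) * (
      Real.Gamma (a + γ + 1) * Real.Gamma (a - γ) * (Real.Gamma a * Real.Gamma (a + 1) /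
      Real.Gamma (2 * a + 1))) :=
    besselMoment_eq (by ring) (by ring) (by ring) (by ring) (by ring)
  have M6 : besselMoment γ γ ((2 * a + 6) / 2 - 3 + γ) = 4 ^ (a - γ) * (
      Real.Gamma (a + γ) * Real.Gamma (a - γ) * (Real.Gamma a * Real.Gamma a /
      Real.Gamma (2 * a))) :=
    besselMoment_eq (by ring) (by ring) (by ring) (by ring) (by ring)
  rw [M0, M1, M2, M3, M4, M5, M6, Gamma_add_four hs, Gamma_add_three hs, Gamma_add_two hs,
    Real.Gamma_add_one hs.ne', Gamma_add_two hd, Gamma_add_two ha0, Real.Gamma_add_one ha0.ne',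
    Gamma_add_four (mul_pos two_pos ha0), Gamma_add_three (mul_pos two_pos ha0),
    Gamma_add_two (mul_pos two_pos ha0), Real.Gamma_add_one (mul_pos two_pos ha0).ne',
    show 2 * a + 6 - 4 = 2 * (a + 1) by ring, show 2 * a + 6 - 6 = 2 * a by ring,
    show 2 * a + 6 - 2 * γ - 4 = 2 * (a - γ + 1) by ring,
    show 2 * a + 6 + 2 * γ - 4 = 2 * (a + γ + 1) by ring,
    show 2 * a + 6 - 2 * γ - 6 = 2 * (a - γ) by ring,
    show 2 * a + 6 + 2 * γ - 6 = 2 * (a + γ) by ring]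
  have hd' := hd.ne'
  have hd1 : a - γ + 1 ≠ 0 := by positivity
  field_simp
  ring

lemma dTwo_eq {n : ℕ} {γ : ℝ} (hγ : 0 < γ) (hn : 2 * γ < n) :
    dTwo n γ = cng n γ *
      (2 * 2 ^ (-(((n : ℝ) - 2 * γ) / 2)) / Real.Gamma (((n : ℝ) - 2 * γ) / 2)) := by
  have h1 := Real.Gamma_pos_of_pos (s := ((n : ℝ) + 2 * γ) / 2) (by positivity)
  have h2 := Real.Gamma_pos_of_pos (s := ((n : ℝ) - 2 * γ) / 2) (by linarith)
  rw [dTwo, cng, div_rpow h1.le h2.le, show ((n : ℝ) + 2 * γ) / (4 * γ) =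
    ((n : ℝ) - 2 * γ) / (4 * γ) + 1 by field_simp; ring, rpow_add_one h2.ne', rpow_neg two_pos.le]
  field_simp

lemma png_sq_mul_extConst_sq {n : ℕ} {γ : ℝ} (hγ : 0 < γ) (hn : 2 * γ < n) :
    png n γ ^ 2 * extConst n γ ^ 2 = cng n γ ^ 2 * (4 ^ (-(n : ℝ))) /
      (Real.Gamma γ ^ 2 * Real.Gamma (((n : ℝ) - 2 * γ) / 2) ^ 2) := by
  have h0 := Real.Gamma_pos_of_pos hγ
  have h1 := Real.Gamma_pos_of_pos (s := ((n : ℝ) + 2 * γ) / 2) (by positivity)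
  have h2 := Real.Gamma_pos_of_pos (s := ((n : ℝ) - 2 * γ) / 2) (by linarith)
  have h4 : (4 : ℝ) ^ (n : ℝ) = 4 ^ ((n : ℝ) / 2) * 4 ^ ((n : ℝ) / 2) := by
    rw [← rpow_add four_pos, add_halves]
  rw [png, extConst, mul_rpow four_pos.le pi_pos.le, rpow_neg four_pos.le, h4]
  field_simp

theorem stmt_18 (n : ℕ) (γ : ℝ) (hγ0 : 0 < γ) (hγ1 : γ < 1) (hn : 2 * γ + 8 < (n : ℝ)) :
    (∫ xN in Set.Ioi (0 : ℝ), ∫ x : EuclideanSpace ℝ (Fin n),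
        xN ^ (1 - 2 * γ) * ‖x‖ ^ 4 * (bubbleExt n γ 1 0 x xN) ^ 2) =
      sphereConst n *
        ((n : ℝ) * ((n : ℝ) + 2) *
            (15 * ((n : ℝ) - 3) ^ 2 * ((n : ℝ) - 5) ^ 2 +
              (1 - 4 * γ ^ 2) * (10 * (n : ℝ) ^ 2 - 80 * (n : ℝ) + 177 - 12 * γ ^ 2)) /
          (15 * ((n : ℝ) - 4) * ((n : ℝ) - 6) * ((n : ℝ) - 2 * γ - 4) *
            ((n : ℝ) + 2 * γ - 4) * ((n : ℝ) - 2 * γ - 6) * ((n : ℝ) + 2 * γ - 6))) *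
        (Aone γ * Btwo n γ) := by
  have hn2 : 2 * γ < n := by linarith
  have hm : (0 : ℝ) < n / 2 := by linarith
  have h0 := Real.Gamma_pos_of_pos hγ0
  have h2 := Real.Gamma_pos_of_pos (s := ((n : ℝ) - 2 * γ) / 2) (by linarith)
  have h3 := Real.Gamma_pos_of_pos hm
  have h4 : (4 : ℝ) ^ (n : ℝ) = 4 ^ ((n : ℝ) / 2) * 4 ^ ((n : ℝ) / 2) := by
    rw [← rpow_add four_pos, add_halves]
  have h5 : (2 * 2 ^ (-(((n : ℝ) - 2 * γ) / 2)) : ℝ) ^ 2 = 4 * (4 ^ γ / 4 ^ ((n : ℝ) / 2)) := by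
    rw [← rpow_sub four_pos, show (4 : ℝ) = 2 ^ (2 : ℝ) by norm_num, ← rpow_mul two_pos.le, mul_pow,
      ← rpow_two (2 ^ (-(((n : ℝ) - 2 * γ) / 2))), ← rpow_mul two_pos.le, rpow_two]
    congr 2
    ring
  rw [integral_weighted_bubbleExt_sq hγ0 hγ1 hn, ← mul_assoc, png_sq_mul_extConst_sq hγ0 hn2,
    energySum_eq hγ0 hγ1 hn, Aone_eq hγ0 hγ1, Btwo_eq hγ0 hn, dTwo_eq hγ0 hn2, mul_pow (cng n γ),
    div_pow, h5, Gamma_add_two hm, sphereConst, rpow_neg four_pos.le, h4,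
    mul_rpow four_pos.le pi_pos.le, rpow_sub_one four_ne_zero]
  generalize besselMoment (-γ) (-γ) (1 - γ) = M₁
  generalize besselMoment γ γ (n / 2 - 1 + γ) = M₂
  generalize (15 * ((n : ℝ) - 3) ^ 2 * ((n : ℝ) - 5) ^ 2 +
    (1 - 4 * γ ^ 2) * (10 * (n : ℝ) ^ 2 - 80 * (n : ℝ) + 177 - 12 * γ ^ 2)) = Q
  generalize (15 * ((n : ℝ) - 4) * ((n : ℝ) - 6) * ((n : ℝ) - 2 * γ - 4) *
            ((n : ℝ) + 2 * γ - 4) * ((n : ℝ) - 2 * γ - 6) * ((n : ℝ) + 2 * γ - 6)) = P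
  have hn0 : (0 : ℝ) < n := by linarith
  field_simp
  ring

end
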